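/- arXiv:2304.03046 — 2 statements merged into one kernel-verified Lean document; each statement's English description precedes it below -/
import Mathlib

section
/- Let ℓ ≥ 1 and let G be a simple graph on n vertices containing no subgraph isomorphic to ℓP_3 (the disjoint union of ℓ paths on 3 vertices). Then: if n < 3ℓ, e(G) ≤ C(n,2), with equality if and only if G = K_n; if 3ℓ ≤ n < 5ℓ − 1, e(G) ≤ C(3ℓ−1,2) + ⌊(n − 3ℓ + 1)/2⌋, with equality if and only if G = K_{3ℓ−1} ∪ M_{n−3ℓ+1}; if n = 5ℓ − 1, e(G) ≤ C(3ℓ−1,2) + ℓ, with equality if and only if G = K_{3ℓ−1} ∪ M_{2ℓ} or G = F_{5ℓ−1,ℓ−1}; and if n > 5ℓ − 1, e(G) ≤ C(ℓ−1,2) + (n − ℓ + 1)(ℓ − 1) + ⌊(n − ℓ + 1)/2⌋, with equality if and only if G = F_{n,ℓ−1}. -/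
open SimpleGraph
open scoped Classical

/-- The largest element of the real spectrum of a real matrix (for a real symmetric
matrix this is the largest eigenvalue). -/
noncomputable def specRad {n : ℕ} (M : Matrix (Fin n) (Fin n) ℝ) : ℝ :=
  sSup (spectrum ℝ M)

/-- The diagonal degree matrix of a simple graph on `Fin n`. -/
noncomputable def degMat {n : ℕ} (G : SimpleGraph (Fin n)) : Matrix (Fin n) (Fin n) ℝ :=
  Matrix.diagonal fun i => (Nat.card {j // G.Adj i j} : ℝ)

/-- The adjacency matrix (over `ℝ`) of a simple graph on `Fin n`. -/
noncomputable def adjMat {n : ℕ} (G : SimpleGraph (Fin n)) : Matrix (Fin n) (Fin n) ℝ :=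
  Matrix.of fun i j => if G.Adj i j then (1 : ℝ) else 0

/-- The `A_α`-spectral radius of a graph: largest eigenvalue of `α D + (1-α) A`. -/
noncomputable def rhoAlpha (α : ℝ) {n : ℕ} (G : SimpleGraph (Fin n)) : ℝ :=
  specRad (α • degMat G + (1 - α) • adjMat G)

/-- The signless Laplacian spectral radius of a graph: largest eigenvalue of `D + A`. -/
noncomputable def qRad {n : ℕ} (G : SimpleGraph (Fin n)) : ℝ :=
  specRad (degMat G + adjMat G)

/-- `G` contains a subgraph isomorphic to the linear forest `⋃ i, P_{k i}`:
there are vertex-disjoint copies of the paths `P_{k i}` in `G`. -/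
def ContainsLinearForest {V : Type*} (G : SimpleGraph V) {ℓ : ℕ} (k : Fin ℓ → ℕ) : Prop :=
  ∃ f : (i : Fin ℓ) → Fin (k i) → V,
    (Function.Injective fun q : (i : Fin ℓ) × Fin (k i) => f q.1 q.2) ∧
    ∀ (i : Fin ℓ) (a b : Fin (k i)),
      (SimpleGraph.pathGraph (k i)).Adj a b → G.Adj (f i a) (f i b)

/-- `G` contains a subgraph isomorphic to `H`. -/
def Contains {V W : Type*} (G : SimpleGraph V) (H : SimpleGraph W) : Prop :=
  ∃ f : W ↪ V, ∀ a b, H.Adj a b → G.Adj (f a) (f b)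

/-- `S_{n,p} = K_p ∇ (empty graph on n-p vertices)`, realized on `Fin n` with the
first `p` vertices forming the dominating clique. -/
def Snp (n p : ℕ) : SimpleGraph (Fin n) :=
  SimpleGraph.fromRel fun i j => i.val < p ∨ j.val < p

/-- `S⁺_{n,p} = K_p ∇ (empty graph on n-p-2 vertices ∪ K_2)`, realized on `Fin n` with the
first `p` vertices forming the dominating clique and the last two vertices adjacent. -/
def SnpPlus (n p : ℕ) : SimpleGraph (Fin n) :=
  SimpleGraph.fromRel fun i j =>
    i.val < p ∨ j.val < p ∨ (n - 2 ≤ i.val ∧ n - 2 ≤ j.val)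

/-- `F_{n,p} = K_p ∇ (t K_2 ∪ r K_1)` where `n - p = 2t + r`, `0 ≤ r < 2`, realized on
`Fin n`: the first `p` vertices form the dominating clique and the remaining vertices
are paired into `t` independent edges (plus possibly one isolated vertex). -/
def Fnp (n p : ℕ) : SimpleGraph (Fin n) :=
  SimpleGraph.fromRel fun i j =>
    i.val < p ∨ j.val < p ∨
      (p ≤ i.val ∧ p ≤ j.val ∧ i.val < p + 2 * ((n - p) / 2) ∧
        j.val < p + 2 * ((n - p) / 2) ∧ (i.val - p) / 2 = (j.val - p) / 2)

/-- The disjoint union of cliques of size `c` on `Fin n` (blocks of consecutive vertices). -/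
def unionCliques (n c : ℕ) : SimpleGraph (Fin n) :=
  SimpleGraph.fromRel fun i j => i.val / c = j.val / c

/-- `K_c ∪ M_{n-c}` on `Fin n`: the first `c` vertices form a clique, the remaining
vertices induce a maximal matching `M_{n-c}` (plus possibly one isolated vertex). -/
def KcupM (n c : ℕ) : SimpleGraph (Fin n) :=
  SimpleGraph.fromRel fun i j =>
    (i.val < c ∧ j.val < c) ∨
      (c ≤ i.val ∧ c ≤ j.val ∧ i.val < c + 2 * ((n - c) / 2) ∧
        j.val < c + 2 * ((n - c) / 2) ∧ (i.val - c) / 2 = (j.val - c) / 2)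

/-- The cubic polynomial `f` from the paper. -/
noncomputable def fpoly (α : ℝ) (n p : ℕ) (x : ℝ) : ℝ :=
  x ^ 3 - ((p : ℝ) + (n : ℝ) * α + (p : ℝ) * α) * x ^ 2 +
    ((p : ℝ) - (n : ℝ) * (p : ℝ) + (n : ℝ) * α - 2 * (p : ℝ) * α + (p : ℝ) ^ 2 +
      (n : ℝ) * (p : ℝ) * α ^ 2 + 2 * (n : ℝ) * (p : ℝ) * α - 1) * x +
    (p : ℝ) ^ 2 * α ^ 2 - 2 * (p : ℝ) + (p : ℝ) ^ 3 * α ^ 2 + (n : ℝ) * (p : ℝ) +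
    5 * (p : ℝ) * α - 2 * α ^ 2 + (p : ℝ) ^ 2 * α - (p : ℝ) ^ 3 * α - (p : ℝ) ^ 2 +
    (n : ℝ) * (p : ℝ) ^ 2 * α - 2 * (n : ℝ) * (p : ℝ) ^ 2 * α ^ 2 -
    2 * (n : ℝ) * (p : ℝ) * α

/-- The cubic polynomial `g` from the paper. -/
noncomputable def gpoly (n p : ℕ) (x : ℝ) : ℝ :=
  x ^ 3 - ((n : ℝ) + 3 * (p : ℝ)) * x ^ 2 +
    (4 * (p : ℝ) ^ 2 + (n : ℝ) * (p : ℝ) + 2 * (n : ℝ) - 4) * x -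
    2 * (p : ℝ) ^ 2 * ((p : ℝ) + 1)

section Packing

variable {V : Type*} (G : SimpleGraph V)

/-- The number of neighbours of `v` inside `S`. -/
noncomputable def degIn (S : Finset V) (v : V) : ℕ := (S.filter (G.Adj v)).card

/-- The sum of the degrees of the subgraph induced on `S`, i.e. twice its number of edges. -/
noncomputable def degSum (S : Finset V) : ℕ := ∑ x ∈ S, degIn G S x

variable {G} in
lemma degIn_mono {S T : Finset V} (h : S ⊆ T) (v : V) : degIn G S v ≤ degIn G T v :=
  Finset.card_le_card (Finset.filter_subset_filter _ h)

variable {G} in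
lemma sum_degIn_comm (A B : Finset V) : ∑ x ∈ A, degIn G B x = ∑ y ∈ B, degIn G A y := by
  simp only [degIn, Finset.card_filter]
  rw [Finset.sum_comm]
  simp only [G.adj_comm]

variable {G} in
lemma adj_of_sum_degIn_eq {A B : Finset V} (h : A.card * B.card ≤ ∑ a ∈ A, degIn G B a) {a b : V}
    (ha : a ∈ A) (hb : b ∈ B) : G.Adj a b := by
  have hle : ∀ v ∈ A, degIn G B v ≤ B.card := fun v _ => Finset.card_filter_le _ _
  have heq : ∑ v ∈ A, degIn G B v = ∑ _v ∈ A, B.card := by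
    refine le_antisymm (Finset.sum_le_sum hle) ?_
    rw [Finset.sum_const, smul_eq_mul]
    exact h
  exact Finset.filter_card_eq ((Finset.sum_eq_sum_iff_of_le hle).1 heq a ha) b hb

variable [DecidableEq V]

/-- `t` is the vertex set of a (not necessarily induced) path on three vertices. -/
def IsPath3 (t : Finset V) : Prop :=
  ∃ a b c, G.Adj a b ∧ G.Adj b c ∧ a ≠ c ∧ t = {a, b, c}

/-- `𝒯` is a family of pairwise disjoint vertex sets of 3-vertex paths inside `S`. -/
structure IsPacking (S : Finset V) (𝒯 : Finset (Finset V)) : Prop where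
  subset : ∀ t ∈ 𝒯, t ⊆ S
  path : ∀ t ∈ 𝒯, IsPath3 G t
  disj : ∀ t ∈ 𝒯, ∀ u ∈ 𝒯, t ≠ u → Disjoint t u

/-- The induced subgraph on `S` contains `k` disjoint 3-vertex paths. -/
def HasPacking (S : Finset V) (k : ℕ) : Prop := ∃ 𝒯, IsPacking G S 𝒯 ∧ 𝒯.card = k

variable {G}

lemma IsPath3.card_eq {t : Finset V} (ht : IsPath3 G t) : t.card = 3 := by
  obtain ⟨a, b, c, hab, hbc, hac, rfl⟩ := ht
  exact Finset.card_eq_three.2 ⟨a, b, c, hab.ne, hac, hbc.ne, rfl⟩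

lemma isPath3_triple {a b c : V} (hab : G.Adj a b) (hac : G.Adj a c) (hbc : b ≠ c) :
    IsPath3 G {a, b, c} :=
  ⟨b, a, c, hab.symm, hac, hbc, by grind⟩

lemma degIn_erase (S : Finset V) {v w : V} (hv : v ∈ S) :
    degIn G S w = degIn G (S.erase v) w + if G.Adj w v then 1 else 0 := by
  unfold degIn
  rw [Finset.filter_erase]
  split_ifs with h
  · rw [Finset.card_erase_add_one (by simp [hv, h])]
  · rw [Finset.erase_eq_of_notMem (by simp [h]), add_zero]

lemma degIn_erase_self (S : Finset V) {v : V} (hv : v ∈ S) :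
    degIn G (S.erase v) v = degIn G S v := by
  simp [degIn_erase (w := v) S hv]

lemma degIn_add_sdiff {S T : Finset V} (h : T ⊆ S) (v : V) :
    degIn G S v = degIn G T v + degIn G (S \ T) v := by
  unfold degIn
  rw [← Finset.card_union_of_disjoint
    (Finset.disjoint_filter_filter Finset.disjoint_sdiff), ← Finset.filter_union,
    Finset.union_sdiff_of_subset h]

lemma degIn_lt_card {S : Finset V} {v : V} (hv : v ∈ S) : degIn G S v + 1 ≤ S.card := by
  rw [← degIn_erase_self S hv, ← Finset.card_erase_add_one hv]
  exact Nat.add_le_add_right (Finset.card_filter_le _ _) 1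

lemma degSum_erase {S : Finset V} {v : V} (hv : v ∈ S) :
    degSum G S = degSum G (S.erase v) + 2 * degIn G S v := by
  unfold degSum
  rw [← Finset.add_sum_erase S _ hv, Finset.sum_congr rfl fun x _ => degIn_erase S hv,
    Finset.sum_add_distrib, ← Finset.card_filter]
  have : (S.erase v).filter (fun x => G.Adj x v) = (S.erase v).filter (G.Adj v) :=
    Finset.filter_congr fun x _ => G.adj_comm x v
  rw [this]
  change _ + (_ + degIn G (S.erase v) v) = _
  rw [degIn_erase_self S hv]
  ring

lemma even_degSum (S : Finset V) : Even (degSum G S) := by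
  induction S using Finset.induction_on with
  | empty => simp [degSum]
  | insert a S ha ih =>
    rw [degSum_erase (Finset.mem_insert_self a S), Finset.erase_insert ha]
    exact ih.add (even_two_mul _)

lemma degSum_le (S : Finset V) : degSum G S ≤ S.card * (S.card - 1) := by
  have := Finset.sum_le_card_nsmul S (degIn G S) (S.card - 1) fun v hv => by
    have := degIn_lt_card (G := G) hv
    omega
  simpa [degSum] using this

/-- Removing a 3-vertex path removes at most the sum of the degrees minus two edges. -/
lemma degSum_sdiff_path {S t : Finset V} (ht : IsPath3 G t) (hS : t ⊆ S) :
    degSum G S + 4 ≤ degSum G (S \ t) + 2 * ∑ v ∈ t, degIn G S v := by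
  obtain ⟨a, b, c, hab, hbc, hac, rfl⟩ := ht
  have ha : a ∈ S := hS (by simp)
  have hb : b ∈ S.erase a := Finset.mem_erase.2 ⟨hab.ne', hS (by simp)⟩
  have hc : c ∈ (S.erase a).erase b :=
    Finset.mem_erase.2 ⟨hbc.ne', Finset.mem_erase.2 ⟨hac.symm, hS (by simp)⟩⟩
  have hsd : S \ {a, b, c} = ((S.erase a).erase b).erase c := by grind
  rw [hsd, degSum_erase ha, degSum_erase hb, degSum_erase hc,
    Finset.sum_insert (by simp [hab.ne, hac]), Finset.sum_pair hbc.ne]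
  have h1 := degIn_erase (G := G) (w := b) S ha
  have h2 := degIn_erase (G := G) (w := c) _ hb
  have h3 := degIn_mono (G := G) (Finset.erase_subset a S) c
  rw [if_pos hab.symm] at h1
  rw [if_pos hbc.symm] at h2
  omega

lemma HasPacking.mono {S T : Finset V} {k : ℕ} (h : S ⊆ T) :
    HasPacking G S k → HasPacking G T k := by
  rintro ⟨𝒯, h𝒯, hk⟩
  exact ⟨𝒯, ⟨fun t ht => (h𝒯.subset t ht).trans h, h𝒯.path, h𝒯.disj⟩, hk⟩

lemma HasPacking.insert_path {S t : Finset V} {k : ℕ} (ht : IsPath3 G t) (hS : t ⊆ S) :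
    HasPacking G (S \ t) k → HasPacking G S (k + 1) := by
  rintro ⟨𝒯, h𝒯, rfl⟩
  have hd : ∀ u ∈ 𝒯, Disjoint t u := fun u hu =>
    (Finset.disjoint_of_subset_left (h𝒯.subset u hu) Finset.sdiff_disjoint).symm
  have hn : t ∉ 𝒯 := fun h => by
    have := ht.card_eq
    have := Finset.disjoint_self_iff_empty t |>.1 (hd t h)
    simp_all
  refine ⟨insert t 𝒯, ⟨?_, ?_, ?_⟩, Finset.card_insert_of_notMem hn⟩
  · intro u hu
    rcases Finset.mem_insert.1 hu with rfl | hu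
    · exact hS
    · exact (h𝒯.subset u hu).trans Finset.sdiff_subset
  · intro u hu
    rcases Finset.mem_insert.1 hu with rfl | hu
    · exact ht
    · exact h𝒯.path u hu
  · intro u hu w hw huw
    rw [Finset.mem_insert] at hu hw
    rcases hu with rfl | hu <;> rcases hw with rfl | hw
    · exact absurd rfl huw
    · exact hd w hw
    · exact (hd u hu).symm
    · exact h𝒯.disj u hu w hw huw

lemma IsPacking.card_biUnion {S : Finset V} {𝒯 : Finset (Finset V)} (h : IsPacking G S 𝒯) :
    (𝒯.biUnion id).card = 3 * 𝒯.card := by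
  rw [Finset.card_biUnion (t := id) h.disj, mul_comm]
  exact Finset.sum_const_nat fun t ht => (h.path t ht).card_eq

lemma IsPacking.biUnion_subset {S : Finset V} {𝒯 : Finset (Finset V)} (h : IsPacking G S 𝒯) :
    𝒯.biUnion id ⊆ S :=
  Finset.biUnion_subset.2 h.subset

/-- Replacing one path of a packing by two disjoint paths that use only its vertices and
uncovered vertices enlarges the packing. -/
lemma IsPacking.exchange {S t t₁ t₂ : Finset V} {𝒯 : Finset (Finset V)} (h : IsPacking G S 𝒯)
    (ht : t ∈ 𝒯) (h₁ : IsPath3 G t₁) (h₂ : IsPath3 G t₂) (hd : Disjoint t₁ t₂)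
    (hs₁ : t₁ ⊆ t ∪ (S \ 𝒯.biUnion id)) (hs₂ : t₂ ⊆ t ∪ (S \ 𝒯.biUnion id)) :
    HasPacking G S (𝒯.card + 1) := by
  have htS := h.subset t ht
  have hsub : t ∪ (S \ 𝒯.biUnion id) ⊆ S := Finset.union_subset htS Finset.sdiff_subset
  rw [← Finset.card_erase_add_one ht]
  refine HasPacking.insert_path h₁ (hs₁.trans hsub) (HasPacking.insert_path h₂ ?_ ?_)
  · exact Finset.subset_sdiff.2 ⟨hs₂.trans hsub, hd.symm⟩
  · refine ⟨𝒯.erase t, ⟨fun u hu => ?_, fun u hu => h.path u (Finset.mem_of_mem_erase hu),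
      fun u hu w hw => h.disj u (Finset.mem_of_mem_erase hu) w (Finset.mem_of_mem_erase hw)⟩, rfl⟩
    obtain ⟨hut, hu⟩ := Finset.mem_erase.1 hu
    have hu' : Disjoint u (t ∪ (S \ 𝒯.biUnion id)) := by
      rw [Finset.disjoint_union_right]
      refine ⟨h.disj u hu t ht hut, ?_⟩
      exact Finset.disjoint_of_subset_left (Finset.subset_biUnion_of_mem id hu)
        Finset.disjoint_sdiff
    exact Finset.subset_sdiff.2 ⟨Finset.subset_sdiff.2 ⟨h.subset u hu,
      Finset.disjoint_of_subset_right hs₁ hu'⟩, Finset.disjoint_of_subset_right hs₂ hu'⟩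

variable (G) in
/-- `U` contains two disjoint 3-vertex paths. -/
def TwoPaths (U : Finset V) : Prop :=
  ∃ t₁ t₂, IsPath3 G t₁ ∧ IsPath3 G t₂ ∧ Disjoint t₁ t₂ ∧ t₁ ⊆ U ∧ t₂ ⊆ U

lemma twoPaths_of_two_le_of_four_le {R U : Finset V} {a b : V} (hab : a ≠ b) (haR : a ∉ R)
    (hbR : b ∉ R) (haU : a ∈ U) (hbU : b ∈ U) (hRU : R ⊆ U) (ha : 2 ≤ degIn G R a)
    (hb : 4 ≤ degIn G R b) : TwoPaths G U := by
  obtain ⟨x, hx, y, hy, hxy⟩ := Finset.one_lt_card.1 (show 1 < (R.filter (G.Adj a)).card from ha)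
  have hc := Finset.le_card_sdiff {x, y} (R.filter (G.Adj b))
  have := Finset.card_le_two (a := x) (b := y)
  have hb' : 1 < (R.filter (G.Adj b) \ {x, y}).card := by
    unfold degIn at hb
    omega
  obtain ⟨z, hz, w, hw, hzw⟩ := Finset.one_lt_card.1 hb'
  simp only [Finset.mem_sdiff, Finset.mem_filter, Finset.mem_insert, Finset.mem_singleton,
    not_or] at hx hy hz hw
  refine ⟨{a, x, y}, {b, z, w}, isPath3_triple hx.2 hy.2 hxy,
    isPath3_triple hz.1.2 hw.1.2 hzw, ?_, ?_, ?_⟩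
  · rw [Finset.disjoint_left]
    grind
  · grind
  · grind

lemma twoPaths_of_common_neighbor {R U : Finset V} {a b c w : V} (hab : a ≠ b) (hac : a ≠ c)
    (hbc : b ≠ c) (haR : a ∉ R) (hbR : b ∉ R) (hcR : c ∉ R) (haU : a ∈ U) (hbU : b ∈ U)
    (hcU : c ∈ U) (hRU : R ⊆ U) (ha : 3 ≤ degIn G R a) (hw : w ∈ R) (hbw : G.Adj b w)
    (hcw : G.Adj c w) : TwoPaths G U := by
  have hc := Finset.pred_card_le_card_erase (s := R.filter (G.Adj a)) (a := w)
  have ha' : 1 < ((R.filter (G.Adj a)).erase w).card := by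
    unfold degIn at ha
    omega
  obtain ⟨x, hx, y, hy, hxy⟩ := Finset.one_lt_card.1 ha'
  simp only [Finset.mem_erase, Finset.mem_filter] at hx hy
  refine ⟨{a, x, y}, {w, b, c}, isPath3_triple hx.2.2 hy.2.2 hxy,
    isPath3_triple hbw.symm hcw.symm hbc, ?_, ?_, ?_⟩
  · rw [Finset.disjoint_left]
    grind
  · grind
  · grind

lemma exists_common_neighbor {R : Finset V} {b c : V}
    (h : R.card < degIn G R b + degIn G R c) : ∃ w ∈ R, G.Adj b w ∧ G.Adj c w := by
  by_contra! hne
  have hd : Disjoint (R.filter (G.Adj b)) (R.filter (G.Adj c)) :=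
    Finset.disjoint_filter.2 hne
  have := Finset.card_le_card (Finset.union_subset (Finset.filter_subset (G.Adj b) R)
    (Finset.filter_subset (G.Adj c) R))
  rw [Finset.card_union_of_disjoint hd] at this
  unfold degIn at h
  omega

lemma twoPaths_of_max_degree {R U : Finset V} {a b c : V} (hab : a ≠ b) (hac : a ≠ c)
    (hbc : b ≠ c) (haR : a ∉ R) (hbR : b ∉ R) (hcR : c ∉ R) (haU : a ∈ U) (hbU : b ∈ U)
    (hcU : c ∈ U) (hRU : R ⊆ U) (hba : degIn G R b ≤ degIn G R a)
    (hca : degIn G R c ≤ degIn G R a)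
    (h7 : 7 ≤ degIn G R a + degIn G R b + degIn G R c)
    (h3 : R.card + 3 ≤ degIn G R a + degIn G R b + degIn G R c)
    (h : R.card + 4 ≤ degIn G R a + degIn G R b + degIn G R c ∨
      10 ≤ degIn G R a + degIn G R b + degIn G R c) : TwoPaths G U := by
  have hle : degIn G R a ≤ R.card := Finset.card_filter_le _ _
  rcases le_or_gt 4 (degIn G R a) with h4 | h4
  · rcases le_or_gt 2 (degIn G R b) with hb | hb
    · exact twoPaths_of_two_le_of_four_le hab.symm hbR haR hbU haU hRU hb h4
    · exact twoPaths_of_two_le_of_four_le hac.symm hcR haR hcU haU hRU (by omega) h4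
  · obtain ⟨w, hw, hbw, hcw⟩ := exists_common_neighbor (G := G) (R := R) (b := b) (c := c)
      (by omega)
    exact twoPaths_of_common_neighbor hab hac hbc haR hbR hcR haU hbU hcU hRU (by omega)
      hw hbw hcw

/-- A 3-vertex path that sends many edges to `R` can be replaced by two disjoint ones. -/
lemma twoPaths_of_sum_degIn {t R : Finset V} (ht : IsPath3 G t) (hd : Disjoint t R)
    (h7 : 7 ≤ ∑ v ∈ t, degIn G R v) (h3 : R.card + 3 ≤ ∑ v ∈ t, degIn G R v)
    (h : R.card + 4 ≤ ∑ v ∈ t, degIn G R v ∨ 10 ≤ ∑ v ∈ t, degIn G R v) :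
    TwoPaths G (t ∪ R) := by
  obtain ⟨a, b, c, hab, hbc, hac, rfl⟩ := ht
  rw [Finset.sum_insert (by simp [hab.ne, hac]), Finset.sum_pair hbc.ne] at h7 h3 h
  have haR : a ∉ R := Finset.disjoint_left.1 hd (by simp)
  have hbR : b ∉ R := Finset.disjoint_left.1 hd (by simp)
  have hcR : c ∉ R := Finset.disjoint_left.1 hd (by simp)
  have haU : a ∈ ({a, b, c} : Finset V) ∪ R := by simp
  have hbU : b ∈ ({a, b, c} : Finset V) ∪ R := by simp
  have hcU : c ∈ ({a, b, c} : Finset V) ∪ R := by simp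
  have hRU : R ⊆ ({a, b, c} : Finset V) ∪ R := Finset.subset_union_right
  by_cases h1 : degIn G R b ≤ degIn G R a ∧ degIn G R c ≤ degIn G R a
  · exact twoPaths_of_max_degree hab.ne hac hbc.ne haR hbR hcR haU hbU hcU hRU h1.1 h1.2
      (by omega) (by omega) (by omega)
  · by_cases h2 : degIn G R c ≤ degIn G R b
    · exact twoPaths_of_max_degree hab.ne' hbc.ne hac hbR haR hcR hbU haU hcU hRU (by omega) h2
        (by omega) (by omega) (by omega)
    · exact twoPaths_of_max_degree hac.symm hbc.ne' hab.ne hcR haR hbR hcU haU hbU hRU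
        (by omega) (by omega) (by omega) (by omega) (by omega)

lemma degIn_le_one_of_no_path {R : Finset V} (h : ∀ t ⊆ R, ¬ IsPath3 G t) {v : V} (hv : v ∈ R) :
    degIn G R v ≤ 1 := by
  by_contra! hlt
  obtain ⟨x, hx, y, hy, hxy⟩ := Finset.one_lt_card.1 hlt
  rw [Finset.mem_filter] at hx hy
  exact h {v, x, y} (by grind) (isPath3_triple hx.2 hy.2 hxy)

/-- The minimum degree forces a packing with more than `p` paths. -/
lemma hasPacking_of_min_degree {S : Finset V} {p D : ℕ} (hp : 1 ≤ p)
    (hD : ∀ v ∈ S, D ≤ degIn G S v)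
    (h : (D = p + 2 ∧ 5 * p + 4 ≤ S.card) ∨ (D = 2 * p + 1 ∧ 3 * p + 3 ≤ S.card)) :
    HasPacking G S (p + 1) := by
  have hmax : ∃ k, k ≤ p + 1 ∧ HasPacking G S k ∧ (k ≤ p → ¬ HasPacking G S (k + 1)) := by
    by_contra! hcon
    have hall : ∀ k, k ≤ p + 1 → HasPacking G S k := by
      intro k
      induction k with
      | zero => exact fun _ => ⟨∅, ⟨by simp, by simp, by simp⟩, rfl⟩
      | succ k ih => exact fun hk => (hcon k (by omega) (ih (by omega))).2
    exact absurd (hcon (p + 1) le_rfl (hall _ le_rfl)).1 (by omega)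
  obtain ⟨k, hk, ⟨𝒯, h𝒯, rfl⟩, hno⟩ := hmax
  rcases hk.eq_or_lt with hk | hk
  · exact hk ▸ ⟨𝒯, h𝒯, rfl⟩
  exfalso
  replace hno := hno (by omega)
  set P := 𝒯.biUnion id with hP
  set R := S \ P with hR
  have hPS : P ⊆ S := h𝒯.biUnion_subset
  have hcard : R.card + 3 * 𝒯.card = S.card := by
    rw [← h𝒯.card_biUnion, Finset.card_sdiff_add_card_eq_card hPS]
  have hRpath : ∀ t ⊆ R, ¬ IsPath3 G t := by
    intro t htR ht
    refine hno (HasPacking.insert_path ht (htR.trans Finset.sdiff_subset) ⟨𝒯, ⟨fun u hu => ?_,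
      h𝒯.path, h𝒯.disj⟩, rfl⟩)
    exact Finset.subset_sdiff.2 ⟨h𝒯.subset u hu, Finset.disjoint_of_subset_left
      (Finset.subset_biUnion_of_mem id hu)
      (Finset.disjoint_of_subset_right htR Finset.disjoint_sdiff)⟩
  have hR1 : ∀ v ∈ R, degIn G R v ≤ 1 := fun v hv => degIn_le_one_of_no_path hRpath hv
  have hsplit : ∀ v ∈ R, D ≤ degIn G P v + degIn G R v := fun v hv => by
    rw [hR, ← degIn_add_sdiff hPS]
    exact hD v (Finset.sdiff_subset hv)
  have hlow : R.card * D ≤ ∑ v ∈ R, degIn G P v + degSum G R := by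
    rw [degSum, ← Finset.sum_add_distrib, ← smul_eq_mul]
    exact Finset.card_nsmul_le_sum _ _ _ hsplit
  have hRsum : degSum G R ≤ R.card := by
    simpa [degSum] using Finset.sum_le_card_nsmul R (degIn G R) 1 hR1
  have hev := even_degSum (G := G) R
  have hswap : ∑ v ∈ R, degIn G P v = ∑ t ∈ 𝒯, ∑ v ∈ t, degIn G R v := by
    rw [sum_degIn_comm, hP, Finset.sum_biUnion (t := id) h𝒯.disj]
    rfl
  have hupper : ∀ t ∈ 𝒯, ∑ v ∈ t, degIn G R v ≤ 6 ∨ ∑ v ∈ t, degIn G R v ≤ R.card + 2 ∨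
      (∑ v ∈ t, degIn G R v ≤ R.card + 3 ∧ ∑ v ∈ t, degIn G R v ≤ 9) := by
    intro t ht
    by_contra! hcon
    have hd : Disjoint t R := Finset.disjoint_of_subset_left
      (Finset.subset_biUnion_of_mem id ht) Finset.disjoint_sdiff
    obtain ⟨t₁, t₂, h₁, h₂, hd', hs₁, hs₂⟩ := twoPaths_of_sum_degIn (h𝒯.path t ht) hd
      (by omega) (by omega) (by omega)
    exact hno (h𝒯.exchange ht h₁ h₂ hd' hs₁ hs₂)
  have hbound : ∀ M, (∀ t ∈ 𝒯, ∑ v ∈ t, degIn G R v ≤ M) →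
      ∑ v ∈ R, degIn G P v ≤ p * M := fun M hM => by
    rw [hswap]
    refine (Finset.sum_le_card_nsmul _ _ _ hM).trans ?_
    rw [smul_eq_mul]
    exact Nat.mul_le_mul_right _ (by omega)
  rcases h with ⟨rfl, hn⟩ | ⟨rfl, hn⟩
  · rcases le_or_gt 7 R.card with h7 | h7
    · have := hbound (R.card + 2) fun t ht => by have := hupper t ht; omega
      nlinarith
    · have := hbound 9 fun t ht => by have := hupper t ht; omega
      have : p = 1 := by omega
      subst this
      omega
  · rcases le_or_gt 4 R.card with h4 | h4
    · have := hbound (R.card + 3) fun t ht => by have := hupper t ht; omega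
      nlinarith
    · have := hbound 6 fun t ht => by have := hupper t ht; omega
      have h3 : R.card = 3 := by omega
      rw [h3] at hlow hRsum
      obtain ⟨m, hm⟩ := hev
      omega

variable (G) in
/-- `S` splits into `3p+2` vertices and a part of maximum degree one, with no edges between. -/
def CliqueType (S : Finset V) (p : ℕ) : Prop :=
  ∃ A ⊆ S, A.card = 3 * p + 2 ∧ (∀ a ∈ A, ∀ b ∈ S \ A, ¬ G.Adj a b) ∧
    ∀ b ∈ S \ A, degIn G (S \ A) b ≤ 1

variable (G) in
/-- Removing `p` vertices from `S` leaves a graph of maximum degree one. -/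
def HubType (S : Finset V) (p : ℕ) : Prop :=
  ∃ A ⊆ S, A.card = p ∧ ∀ b ∈ S \ A, degIn G (S \ A) b ≤ 1

variable (G) in
/-- The bound on twice the number of edges inside `S`, with the structure in case of equality. -/
def TuranBound (S : Finset V) (p : ℕ) : Prop :=
  (3 * p + 2 ≤ S.card → S.card < 5 * p + 4 →
    degSum G S + (S.card + p) % 2 ≤ 9 * p * p + 6 * p + S.card ∧
    (degSum G S + (S.card + p) % 2 = 9 * p * p + 6 * p + S.card → CliqueType G S p)) ∧
  (5 * p + 4 ≤ S.card →
    degSum G S + (S.card + p) % 2 + p * p + 2 * p ≤ 2 * p * S.card + S.card ∧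
    (degSum G S + (S.card + p) % 2 + p * p + 2 * p = 2 * p * S.card + S.card →
      HubType G S p ∨ S.card = 5 * p + 4 ∧ CliqueType G S p))

lemma HubType.of_erase {S : Finset V} {p : ℕ} {v : V} (hv : v ∈ S) :
    HubType G (S.erase v) p → HubType G S (p + 1) := by
  rintro ⟨A, hA, hc, h⟩
  have hvA : v ∉ A := fun h => by simpa using hA h
  refine ⟨insert v A, Finset.insert_subset hv (hA.trans (Finset.erase_subset v S)),
    by rw [Finset.card_insert_of_notMem hvA, hc], ?_⟩
  have : S \ insert v A = S.erase v \ A := by grind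
  rwa [this]

lemma CliqueType.of_erase {S : Finset V} {p : ℕ} {v : V} (hv : v ∈ S) (hd : degIn G S v = 0) :
    CliqueType G (S.erase v) p → CliqueType G S p := by
  rintro ⟨A, hA, hc, h₁, h₂⟩
  have hvA : v ∉ A := fun h => by simpa using hA h
  have hn : ∀ x ∈ S, ¬ G.Adj v x := by simpa [degIn, Finset.filter_eq_empty_iff] using hd
  have hAS := hA.trans (Finset.erase_subset v S)
  have he : S.erase v \ A = (S \ A).erase v := by grind
  have hvS : v ∈ S \ A := by grind
  rw [he] at h₁ h₂
  refine ⟨A, hAS, hc, fun a ha b hb hab => ?_, fun b hb => ?_⟩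
  · rcases eq_or_ne b v with rfl | hbv
    · exact hn a (hAS ha) hab.symm
    · exact h₁ a ha b (Finset.mem_erase.2 ⟨hbv, hb⟩) hab
  · rcases eq_or_ne b v with rfl | hbv
    · exact (degIn_mono Finset.sdiff_subset b).trans (by omega)
    · rw [degIn_erase _ hvS, if_neg fun h => hn b (Finset.sdiff_subset hb) h.symm]
      exact h₂ b (Finset.mem_erase.2 ⟨hbv, hb⟩)

lemma CliqueType.of_erase_erase {S : Finset V} {p : ℕ} {v w : V} (hv : v ∈ S) (hw : w ∈ S)
    (hvw : G.Adj v w) (hdv : degIn G S v = 1) (hdw : degIn G S w = 1) :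
    CliqueType G ((S.erase v).erase w) p → CliqueType G S p := by
  rintro ⟨A, hA, hc, h₁, h₂⟩
  have hn : ∀ {x y : V}, G.Adj x y → degIn G S x = 1 → y ∈ S → ∀ z ∈ S, G.Adj x z → z = y := by
    intro x y hxy hdx hy z hz hxz
    exact Finset.card_le_one.1 hdx.le z (by simp [hz, hxz]) y (by simp [hy, hxy])
  have hnv := hn hvw hdv hw
  have hnw := hn hvw.symm hdw hv
  have hAS : A ⊆ S := by grind
  refine ⟨A, hAS, hc, fun a ha b hb hab => ?_, fun b hb => ?_⟩
  · by_cases hb' : b ∈ (S.erase v).erase w \ A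
    · exact h₁ a ha b hb' hab
    · have : b = v ∨ b = w := by grind
      rcases this with rfl | rfl
      · have := hnv a (hAS ha) hab.symm
        grind
      · have := hnw a (hAS ha) hab.symm
        grind
  · by_cases hb' : b ∈ (S.erase v).erase w \ A
    · refine le_trans (le_of_eq ?_) (h₂ b hb')
      unfold degIn
      congr 1
      ext z
      simp only [Finset.mem_filter, Finset.mem_sdiff, Finset.mem_erase]
      constructor
      · rintro ⟨⟨hz, hzA⟩, hbz⟩
        refine ⟨⟨⟨?_, ?_, hz⟩, hzA⟩, hbz⟩
        · rintro rfl
          have := hnw b (by grind) hbz.symm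
          grind
        · rintro rfl
          have := hnv b (by grind) hbz.symm
          grind
      · rintro ⟨⟨⟨-, -, hz⟩, hzA⟩, hbz⟩
        exact ⟨⟨hz, hzA⟩, hbz⟩
    · have : b = v ∨ b = w := by grind
      rcases this with rfl | rfl
      · exact (degIn_mono Finset.sdiff_subset _).trans hdv.le
      · exact (degIn_mono Finset.sdiff_subset _).trans hdw.le

/-- A vertex of large degree extends every packing avoiding it. -/
lemma HasPacking.of_erase {S : Finset V} {k : ℕ} {v : V} (hv : v ∈ S)
    (hd : 3 * k + 2 ≤ degIn G S v) :
    HasPacking G (S.erase v) k → HasPacking G S (k + 1) := by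
  rintro ⟨𝒯, h𝒯, rfl⟩
  have hc := Finset.le_card_sdiff (𝒯.biUnion id) (S.filter (G.Adj v))
  rw [h𝒯.card_biUnion] at hc
  have hlt : 1 < (S.filter (G.Adj v) \ 𝒯.biUnion id).card := by
    unfold degIn at hd
    omega
  obtain ⟨x, hx, y, hy, hxy⟩ := Finset.one_lt_card.1 hlt
  rw [Finset.mem_sdiff, Finset.mem_filter] at hx hy
  refine HasPacking.insert_path (isPath3_triple hx.1.2 hy.1.2 hxy) (by grind)
    ⟨𝒯, ⟨fun u hu => ?_, h𝒯.path, h𝒯.disj⟩, rfl⟩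
  have h₁ := h𝒯.subset u hu
  have h₂ : u ⊆ 𝒯.biUnion id := Finset.subset_biUnion_of_mem id hu
  intro z hz
  have := h₁ hz
  have := h₂ hz
  grind

lemma TuranBound.of_erase_high {S : Finset V} {q : ℕ} {v : V} (hv : v ∈ S)
    (hd : 3 * q + 5 ≤ degIn G S v) (h : TuranBound G (S.erase v) q) :
    TuranBound G S (q + 1) := by
  have hdeg := degIn_lt_card (G := G) hv
  have hsum := degSum_erase (G := G) hv
  have hcard := Finset.card_erase_add_one hv
  unfold TuranBound at h ⊢
  generalize (S.erase v).card = m at *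
  rw [← hcard] at hdeg ⊢
  have hpar : (m + 1 + (q + 1)) % 2 = (m + q) % 2 := by omega
  rw [hpar]
  refine ⟨fun h₁ h₂ => ?_, fun h₁ => ?_⟩
  · rcases lt_or_ge m (5 * q + 4) with hm | hm
    · have := (h.1 (by omega) hm).1
      have : degSum G S + (m + q) % 2 < 9 * (q + 1) * (q + 1) + 6 * (q + 1) + (m + 1) := by
        nlinarith
      exact ⟨this.le, fun he => absurd he this.ne⟩
    · have := (h.2 hm).1
      have : degSum G S + (m + q) % 2 < 9 * (q + 1) * (q + 1) + 6 * (q + 1) + (m + 1) := by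
        nlinarith
      exact ⟨this.le, fun he => absurd he this.ne⟩
  · have := h.2 (by omega)
    refine ⟨by nlinarith, fun he => Or.inl (HubType.of_erase hv ?_)⟩
    exact (this.2 (by nlinarith)).resolve_right fun hc => by omega

lemma TuranBound.of_erase_isolated {S : Finset V} {p : ℕ} {v : V} (hp : 1 ≤ p) (hv : v ∈ S)
    (hS : 3 * p + 3 ≤ S.card) (hd : degIn G S v = 0) (h : TuranBound G (S.erase v) p) :
    TuranBound G S p := by
  have hsum := degSum_erase (G := G) hv
  have hcard := Finset.card_erase_add_one hv
  have htype := CliqueType.of_erase (p := p) hv hd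
  unfold TuranBound at h ⊢
  generalize (S.erase v).card = m at *
  rw [← hcard] at hS ⊢
  rw [hd, mul_zero, add_zero] at hsum
  rw [hsum]
  refine ⟨fun h₁ h₂ => ?_, fun h₁ => ?_⟩
  · have := h.1 (by omega) (by omega)
    generalize 9 * p * p = x at *
    exact ⟨by omega, fun he => htype (this.2 (by omega))⟩
  · rcases lt_or_ge m (5 * p + 4) with hm | hm
    · obtain rfl : m = 5 * p + 3 := by omega
      have := h.1 (by omega) hm
      have e₁ : 2 * p * (5 * p + 3 + 1) = p * p + 9 * p * p + 8 * p := by ring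
      rw [e₁]
      generalize 9 * p * p = x at *
      generalize p * p = y at *
      exact ⟨by omega, fun he => Or.inr ⟨by omega, htype (this.2 (by omega))⟩⟩
    · have := (h.2 hm).1
      have e₁ : 2 * p * (m + 1) = 2 * p * m + 2 * p := by ring
      rw [e₁]
      generalize 2 * p * m = x at *
      generalize p * p = y at *
      exact ⟨by omega, fun he => by omega⟩

lemma TuranBound.of_erase_edge {S : Finset V} {p : ℕ} {v w : V} (hp : 1 ≤ p) (hv : v ∈ S)
    (hw : w ∈ S) (hvw : G.Adj v w) (hS : 3 * p + 3 ≤ S.card) (hdv : degIn G S v = 1)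
    (hdw : degIn G S w = 1) (h : TuranBound G ((S.erase v).erase w) p) :
    TuranBound G S p := by
  have hw' : w ∈ S.erase v := Finset.mem_erase.2 ⟨hvw.ne', hw⟩
  have hsum := degSum_erase (G := G) hv
  have hsum' := degSum_erase (G := G) hw'
  have hd' := degIn_erase (G := G) (w := w) S hv
  have hcard := Finset.card_erase_add_one hv
  have hcard' := Finset.card_erase_add_one hw'
  have htype := CliqueType.of_erase_erase (p := p) hv hw hvw hdv hdw
  have htriv := degSum_le (G := G) ((S.erase v).erase w)
  unfold TuranBound at h ⊢
  rw [if_pos hvw.symm] at hd'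
  obtain ⟨m, hm⟩ : ∃ m, ((S.erase v).erase w).card = m := ⟨_, rfl⟩
  have hcS : S.card = m + 2 := by omega
  rw [hm] at h htriv
  rw [hcS] at hS ⊢
  have hsum2 : degSum G S = degSum G ((S.erase v).erase w) + 2 := by omega
  rw [hsum2]
  have hpar : (m + 2 + p) % 2 = (m + p) % 2 := by omega
  rw [hpar]
  refine ⟨fun h₁ h₂ => ?_, fun h₁ => ?_⟩
  · rcases lt_or_ge m (3 * p + 2) with hlt | hge
    · obtain rfl : m = 3 * p + 1 := by omega
      have e₁ : (3 * p + 1) * (3 * p + 1 - 1) = 9 * p * p + 3 * p := by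
        rw [Nat.add_sub_cancel]; ring
      rw [e₁] at htriv
      generalize 9 * p * p = x at *
      exact ⟨by omega, fun he => by omega⟩
    · have := h.1 hge (by omega)
      generalize 9 * p * p = x at *
      exact ⟨by omega, fun he => htype (this.2 (by omega))⟩
  · rcases lt_or_ge m (5 * p + 4) with hlt | hge
    · have := h.1 (by omega) hlt
      have hm' : m = 5 * p + 2 ∨ m = 5 * p + 3 := by omega
      rcases hm' with rfl | rfl
      · have e₁ : 2 * p * (5 * p + 2 + 2) = p * p + 9 * p * p + 8 * p := by ring
        rw [e₁]
        generalize 9 * p * p = x at *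
        generalize p * p = y at *
        exact ⟨by omega, fun he => Or.inr ⟨by omega, htype (this.2 (by omega))⟩⟩
      · have e₁ : 2 * p * (5 * p + 3 + 2) = p * p + 9 * p * p + 10 * p := by ring
        rw [e₁]
        generalize 9 * p * p = x at *
        generalize p * p = y at *
        exact ⟨by omega, fun he => by omega⟩
    · have := (h.2 hge).1
      have e₁ : 2 * p * (m + 2) = 2 * p * m + 4 * p := by ring
      rw [e₁]
      generalize 2 * p * m = x at *
      generalize p * p = y at *
      exact ⟨by omega, fun he => by omega⟩

/-- If all degrees are at most `3p+1` and every vertex lies on a 3-vertex path, the bound holds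
strictly. -/
lemma TuranBound.of_all_on_path {S : Finset V} {q : ℕ} (hS : 3 * q + 6 ≤ S.card)
    (hno : ¬ HasPacking G S (q + 2)) (hmax : ∀ v ∈ S, degIn G S v ≤ 3 * q + 4)
    (hpath : ∀ v ∈ S, ∃ t ⊆ S, v ∈ t ∧ IsPath3 G t)
    (hrec : ∀ t ⊆ S, IsPath3 G t → TuranBound G (S \ t) q) :
    TuranBound G S (q + 1) := by
  have key : ∀ v ∈ S, ∃ t ⊆ S, IsPath3 G t ∧
      degSum G S ≤ degSum G (S \ t) + 2 * degIn G S v + 12 * (q + 1) := by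
    intro v hv
    obtain ⟨t, htS, hvt, ht⟩ := hpath v hv
    refine ⟨t, htS, ht, ?_⟩
    have h₁ := degSum_sdiff_path ht htS
    rw [← Finset.add_sum_erase t _ hvt] at h₁
    have h₂ : ∑ x ∈ t.erase v, degIn G S x ≤ (t.erase v).card • (3 * q + 4) :=
      Finset.sum_le_card_nsmul _ _ _ fun x hx => hmax x (htS (Finset.mem_of_mem_erase hx))
    have h₃ := Finset.card_erase_add_one hvt
    rw [ht.card_eq] at h₃
    rw [show (t.erase v).card = 2 by omega, smul_eq_mul] at h₂
    omega
  have hcard : ∀ t ⊆ S, IsPath3 G t → (S \ t).card + 3 = S.card := fun t htS ht => by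
    rw [← ht.card_eq, Finset.card_sdiff_add_card_eq_card htS]
  unfold TuranBound
  generalize hn : S.card = n at *
  refine ⟨fun h₁ h₂ => ?_, fun h₁ => ?_⟩
  · suffices hlt : degSum G S + (n + (q + 1)) % 2 < 9 * (q + 1) * (q + 1) + 6 * (q + 1) + n from
      ⟨hlt.le, fun he => absurd he hlt.ne⟩
    by_contra! hge
    refine hno (hasPacking_of_min_degree (D := 2 * (q + 1) + 1) (by omega) (fun v hv => ?_)
      (Or.inr ⟨rfl, by omega⟩))
    obtain ⟨t, htS, ht, hle⟩ := key v hv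
    have hb := hrec t htS ht
    unfold TuranBound at hb
    have hc := hcard t htS ht
    generalize (S \ t).card = m at *
    subst hc
    have hpar : (m + 3 + (q + 1)) % 2 = (m + q) % 2 := by omega
    rw [hpar] at hge
    rcases lt_or_ge m (5 * q + 4) with hm | hm
    · have := (hb.1 (by omega) hm).1
      by_contra! hlt
      nlinarith
    · have := (hb.2 hm).1
      have hm' : m = 5 * q + 4 ∨ m = 5 * q + 5 := by omega
      by_contra! hlt
      rcases hm' with rfl | rfl <;> nlinarith
  · suffices hlt : degSum G S + (n + (q + 1)) % 2 + (q + 1) * (q + 1) + 2 * (q + 1) <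
        2 * (q + 1) * n + n from ⟨hlt.le, fun he => absurd he hlt.ne⟩
    by_contra! hge
    refine hno (hasPacking_of_min_degree (D := q + 1 + 2) (by omega) (fun v hv => ?_)
      (Or.inl ⟨rfl, by omega⟩))
    obtain ⟨t, htS, ht, hle⟩ := key v hv
    have hb := hrec t htS ht
    unfold TuranBound at hb
    have hc := hcard t htS ht
    generalize (S \ t).card = m at *
    subst hc
    have hpar : (m + 3 + (q + 1)) % 2 = (m + q) % 2 := by omega
    rw [hpar] at hge
    have := (hb.2 (by omega)).1
    by_contra! hlt
    nlinarith

lemma turanBound_zero {S : Finset V} (hno : ¬ HasPacking G S 1) : TuranBound G S 0 := by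
  have hd : ∀ v ∈ S, degIn G S v ≤ 1 := fun v hv => degIn_le_one_of_no_path
    (fun t ht hp => hno (HasPacking.insert_path hp ht
      ⟨∅, ⟨by simp, by simp, by simp⟩, rfl⟩)) hv
  have hsum : degSum G S ≤ S.card := by
    simpa [degSum] using Finset.sum_le_card_nsmul S (degIn G S) 1 hd
  obtain ⟨m, hm⟩ := even_degSum (G := G) S
  unfold TuranBound
  refine ⟨fun h₁ h₂ => ⟨by omega, fun he => ?_⟩, fun h₁ => ⟨by omega, fun _ => Or.inl
    ⟨∅, by simp, rfl, by simpa using hd⟩⟩⟩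
  have hne : ∑ x ∈ S, degIn G S x ≠ 0 := by
    change degSum G S ≠ 0
    omega
  obtain ⟨x, hx, hxd⟩ := Finset.exists_ne_zero_of_sum_ne_zero hne
  obtain ⟨y, hy⟩ := Finset.card_ne_zero.1 hxd
  rw [Finset.mem_filter] at hy
  have huniq : ∀ {a b c : V}, a ∈ S → b ∈ S → c ∈ S → G.Adj a b → G.Adj a c → b = c :=
    fun ha hb hc hab hac => Finset.card_le_one.1 (hd _ ha) _ (by simp [hb, hab]) _
      (by simp [hc, hac])
  refine ⟨{x, y}, by grind, Finset.card_pair hy.2.ne, fun a ha b hb hab => ?_, fun b hb =>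
    (degIn_mono Finset.sdiff_subset b).trans (hd b (Finset.sdiff_subset hb))⟩
  have hxy := hy.2
  have hyx := hy.2.symm
  simp only [Finset.mem_insert, Finset.mem_singleton, Finset.mem_sdiff, not_or] at ha hb
  rcases ha with rfl | rfl
  · exact hb.2.2 (huniq hx hb.1 hy.1 hab hxy)
  · exact hb.2.1 (huniq hy.1 hb.1 hx hab hyx)

theorem turanBound_of_not_hasPacking (S : Finset V) :
    ∀ p, ¬ HasPacking G S (p + 1) → TuranBound G S p := by
  induction S using Finset.strongInduction with
  | H S ih =>
  intro p hno
  rcases p with _ | q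
  · exact turanBound_zero hno
  rcases lt_or_ge S.card (3 * (q + 1) + 3) with hlt | hS
  · unfold TuranBound
    refine ⟨fun h₁ h₂ => ?_, fun h₁ => by omega⟩
    have hS : S.card = 3 * (q + 1) + 2 := by omega
    have hle := degSum_le (G := G) S
    refine ⟨?_, fun _ => ⟨S, subset_rfl, hS, by simp, by simp⟩⟩
    rw [hS] at hle ⊢
    rw [show 3 * (q + 1) + 2 - 1 = 3 * q + 4 by omega] at hle
    have hmod : (3 * (q + 1) + 2 + (q + 1)) % 2 = 0 := by omega
    rw [hmod]
    nlinarith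
  by_cases hhigh : ∃ v ∈ S, 3 * q + 5 ≤ degIn G S v
  · obtain ⟨v, hv, hd⟩ := hhigh
    exact TuranBound.of_erase_high hv hd (ih _ (Finset.erase_ssubset hv) q fun hp =>
      hno (hp.of_erase hv (by omega)))
  by_cases hiso : ∃ v ∈ S, degIn G S v = 0
  · obtain ⟨v, hv, hd⟩ := hiso
    exact TuranBound.of_erase_isolated (by omega) hv hS hd
      (ih _ (Finset.erase_ssubset hv) (q + 1) fun hp => hno (hp.mono (Finset.erase_subset v S)))
  by_cases hedge : ∃ v ∈ S, ∃ w ∈ S, G.Adj v w ∧ degIn G S v = 1 ∧ degIn G S w = 1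
  · obtain ⟨v, hv, w, hw, hvw, hdv, hdw⟩ := hedge
    exact TuranBound.of_erase_edge (by omega) hv hw hvw hS hdv hdw
      (ih _ ((Finset.erase_subset _ _).trans_ssubset (Finset.erase_ssubset hv)) (q + 1) fun hp =>
        hno (hp.mono ((Finset.erase_subset _ _).trans (Finset.erase_subset v S))))
  push Not at hhigh hiso hedge
  have hcenter : ∀ v ∈ S, 2 ≤ degIn G S v → ∀ x ∈ S, G.Adj v x →
      ∃ t ⊆ S, v ∈ t ∧ x ∈ t ∧ IsPath3 G t := by
    intro v hv hd x hx hvx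
    obtain ⟨y, hy, hyx⟩ := Finset.exists_mem_ne (show 1 < (S.filter (G.Adj v)).card from hd) x
    rw [Finset.mem_filter] at hy
    exact ⟨{v, x, y}, by grind, by simp, by simp, isPath3_triple hvx hy.2 hyx.symm⟩
  refine TuranBound.of_all_on_path (by omega) hno
    (fun v hv => by have := hhigh v hv; omega) (fun v hv => ?_) fun t htS ht =>
    ih _ (Finset.sdiff_ssubset htS (Finset.card_pos.1 (by rw [ht.card_eq]; omega))) q fun hp =>
      hno (hp.insert_path ht htS)
  obtain ⟨x, hx⟩ := Finset.card_ne_zero.1 (hiso v hv)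
  rw [Finset.mem_filter] at hx
  rcases le_or_gt 2 (degIn G S v) with hd | hd
  · obtain ⟨t, htS, hvt, -, ht⟩ := hcenter v hv hd x hx.1 hx.2
    exact ⟨t, htS, hvt, ht⟩
  · have h₁ := hiso v hv
    have h₂ := hedge v hv x hx.1 hx.2 (by omega)
    have h₃ := hiso x hx.1
    obtain ⟨t, htS, -, hvt, ht⟩ := hcenter x hx.1 (by omega) v hv hx.2.symm
    exact ⟨t, htS, hvt, ht⟩

lemma degSum_split {S A : Finset V} (hA : A ⊆ S) :
    degSum G S = degSum G A + degSum G (S \ A) + 2 * ∑ a ∈ A, degIn G (S \ A) a := by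
  have h₁ : ∑ x ∈ A, degIn G S x = degSum G A + ∑ a ∈ A, degIn G (S \ A) a := by
    rw [degSum, ← Finset.sum_add_distrib]
    exact Finset.sum_congr rfl fun x _ => degIn_add_sdiff hA x
  have h₂ : ∑ x ∈ S \ A, degIn G S x = ∑ a ∈ A, degIn G (S \ A) a + degSum G (S \ A) := by
    rw [sum_degIn_comm A, degSum, ← Finset.sum_add_distrib]
    exact Finset.sum_congr rfl fun x _ => degIn_add_sdiff hA x
  rw [degSum, ← Finset.sum_sdiff hA, h₁, h₂]
  ring

lemma adj_of_degSum_eq {A : Finset V} (h : A.card * (A.card - 1) ≤ degSum G A) {a b : V}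
    (ha : a ∈ A) (hb : b ∈ A) (hab : a ≠ b) : G.Adj a b := by
  have hle : ∀ v ∈ A, degIn G A v ≤ A.card - 1 := fun v hv => by
    have := degIn_lt_card (G := G) hv
    omega
  have heq : ∑ v ∈ A, degIn G A v = ∑ _v ∈ A, (A.card - 1) := by
    refine le_antisymm (Finset.sum_le_sum hle) ?_
    rw [Finset.sum_const, smul_eq_mul]
    exact h
  have hda := (Finset.sum_eq_sum_iff_of_le hle).1 heq a ha
  rw [← degIn_erase_self A ha, ← Finset.card_erase_of_mem ha] at hda
  exact Finset.filter_card_eq hda b (Finset.mem_erase.2 ⟨hab.symm, hb⟩)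

/-- A graph of maximum degree one with at most one isolated vertex can be listed so that
consecutive pairs are adjacent. -/
lemma exists_list_pairs (B : Finset V) (h₁ : ∀ v ∈ B, degIn G B v ≤ 1)
    (h₂ : B.card ≤ degSum G B + 1) :
    ∃ L : List V, L.Nodup ∧ L.toFinset = B ∧
      ∀ i (h : 2 * i + 1 < L.length), G.Adj L[2 * i] L[2 * i + 1] := by
  induction B using Finset.strongInduction with
  | H B ih =>
  rcases lt_or_ge 1 B.card with hB | hB
  · have hne : ∑ x ∈ B, degIn G B x ≠ 0 := by
      change degSum G B ≠ 0
      omega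
    obtain ⟨x, hx, hxd⟩ := Finset.exists_ne_zero_of_sum_ne_zero hne
    obtain ⟨y, hy⟩ := Finset.card_ne_zero.1 hxd
    rw [Finset.mem_filter] at hy
    have hyx : y ∈ B.erase x := Finset.mem_erase.2 ⟨hy.2.ne', hy.1⟩
    have hs₁ := degSum_erase (G := G) hx
    have hs₂ := degSum_erase (G := G) hyx
    have hd := degIn_erase (G := G) (w := y) B hx
    rw [if_pos hy.2.symm] at hd
    have hdx := h₁ x hx
    have hdy := h₁ y hy.1
    have hc₁ := Finset.card_erase_add_one hx
    have hc₂ := Finset.card_erase_add_one hyx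
    have hsub : (B.erase x).erase y ⊆ B := (Finset.erase_subset _ _).trans (Finset.erase_subset _ _)
    obtain ⟨L, hL, hLB, hadj⟩ := ih ((B.erase x).erase y)
      ((Finset.erase_subset _ _).trans_ssubset (Finset.erase_ssubset hx))
      (fun v hv => (degIn_mono hsub v).trans (h₁ v (hsub hv))) (by omega)
    have hmem : ∀ z, z ∈ L ↔ z ∈ (B.erase x).erase y := fun z => by rw [← hLB, List.mem_toFinset]
    refine ⟨x :: y :: L, ?_, ?_, ?_⟩
    · simp [hmem, hL, hy.2.ne]
    · ext z
      simp only [List.mem_toFinset, List.mem_cons, hmem, Finset.mem_erase]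
      grind
    · rintro (_ | i) h
      · simpa using hy.2
      · have := hadj i (by simp at h; omega)
        simpa [Nat.mul_add] using this
  · refine ⟨B.toList, B.nodup_toList, B.toList_toFinset, fun i h => ?_⟩
    rw [Finset.length_toList] at h
    omega

end Packing

section Extremal

variable {n : ℕ}

lemma degSum_univ (G : SimpleGraph (Fin n)) :
    degSum G Finset.univ = 2 * Nat.card G.edgeSet := by
  rw [Nat.card_eq_fintype_card, ← SimpleGraph.edgeFinset_card,
    ← G.sum_degrees_eq_twice_card_edges]
  refine Finset.sum_congr rfl fun v _ => ?_
  rw [degIn, ← SimpleGraph.card_neighborFinset_eq_degree, SimpleGraph.neighborFinset_eq_filter]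

lemma card_edgeSet_eq_of_iso {G H : SimpleGraph (Fin n)} (h : Nonempty (G ≃g H)) :
    Nat.card G.edgeSet = Nat.card H.edgeSet :=
  h.elim fun φ => Nat.card_congr φ.mapEdgeSet

lemma eq_of_le_of_card_edgeSet_le {G H : SimpleGraph (Fin n)} (h : G ≤ H)
    (hc : Nat.card H.edgeSet ≤ Nat.card G.edgeSet) : G = H :=
  SimpleGraph.edgeSet_injective
    (Set.eq_of_subset_of_ncard_le (SimpleGraph.edgeSet_mono h) hc)

lemma iso_of_injective_hom {G H : SimpleGraph (Fin n)} (f : Fin n → Fin n)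
    (hf : Function.Injective f) (hadj : ∀ i j, H.Adj i j → G.Adj (f i) (f j))
    (hc : Nat.card G.edgeSet ≤ Nat.card H.edgeSet) : Nonempty (G ≃g H) := by
  let φ : Fin n ≃ Fin n := Equiv.ofBijective f (Finite.injective_iff_bijective.1 hf)
  have hiso : G.comap φ ≃g G := SimpleGraph.Iso.comap φ G
  have hle : H ≤ G.comap φ := fun i j hij => hadj i j hij
  have := eq_of_le_of_card_edgeSet_le hle
    ((card_edgeSet_eq_of_iso ⟨hiso⟩).trans_le hc)
  rw [this]
  exact ⟨hiso.symm⟩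

lemma card_filter_val_lt {c : ℕ} (hc : c ≤ n) :
    (Finset.univ.filter fun i : Fin n => i.val < c).card = c := by
  rw [Fin.card_filter_val_lt, min_eq_right hc]

/-- Lower bound for the number of edges of a graph with a clique on the first `c` vertices and
consecutive pairs of the remaining vertices adjacent. -/
lemma le_degSum_of_clique_of_pairs {H : SimpleGraph (Fin n)} {c : ℕ} (hc : c ≤ n)
    (hA : ∀ i j : Fin n, i.val < c → j.val < c → i ≠ j → H.Adj i j)
    (hB : ∀ i j : Fin n, ∀ k, i.val = c + 2 * k → j.val = c + 2 * k + 1 → H.Adj i j) :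
    c * (c - 1) + 2 * ((n - c) / 2) +
      2 * ∑ a ∈ Finset.univ.filter (fun i : Fin n => i.val < c),
        degIn H (Finset.univ \ Finset.univ.filter fun i : Fin n => i.val < c) a ≤
      degSum H Finset.univ := by
  have hcard := card_filter_val_lt hc
  set A := Finset.univ.filter fun i : Fin n => i.val < c with hAdef
  rw [degSum_split (Finset.subset_univ A)]
  refine Nat.add_le_add_right (Nat.add_le_add ?_ ?_) _
  · have : ∀ v ∈ A, c - 1 ≤ degIn H A v := fun v hv => by
      rw [← degIn_erase_self A hv, ← hcard, ← Finset.card_erase_of_mem hv]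
      refine Finset.card_le_card fun w hw => ?_
      simp only [hAdef, Finset.mem_erase, Finset.mem_filter, Finset.mem_univ, true_and] at hw hv ⊢
      exact ⟨hw, hA v w hv hw.2 hw.1.symm⟩
    simpa [hcard, degSum] using Finset.card_nsmul_le_sum A _ _ this
  · have hsub : (Finset.univ.filter fun i : Fin n => i.val < c + 2 * ((n - c) / 2)) \ A ⊆
        Finset.univ \ A := Finset.sdiff_subset_sdiff (Finset.subset_univ _) subset_rfl
    have hcard' : ((Finset.univ.filter fun i : Fin n => i.val < c + 2 * ((n - c) / 2)) \ A).card =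
        2 * ((n - c) / 2) := by
      rw [Finset.card_sdiff_of_subset, card_filter_val_lt (by omega), hcard,
        Nat.add_sub_cancel_left]
      intro i hi
      simp only [hAdef, Finset.mem_filter, Finset.mem_univ, true_and] at hi ⊢
      omega
    refine le_trans ?_ (Finset.sum_le_sum_of_subset hsub)
    have : ∀ v ∈ (Finset.univ.filter fun i : Fin n => i.val < c + 2 * ((n - c) / 2)) \ A,
        1 ≤ degIn H (Finset.univ \ A) v := by
      intro v hv
      simp only [hAdef, Finset.mem_sdiff, Finset.mem_filter, Finset.mem_univ, true_and,
        not_lt] at hv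
      refine Finset.card_pos.2 ?_
      rcases Nat.even_or_odd' (v.val - c) with ⟨k, hk | hk⟩
      · refine ⟨⟨v.val + 1, by omega⟩, ?_⟩
        simp only [hAdef, Finset.mem_sdiff, Finset.mem_filter, Finset.mem_univ, true_and, not_lt]
        exact ⟨by omega, hB _ _ k (by omega) (by simp; omega)⟩
      · refine ⟨⟨v.val - 1, by omega⟩, ?_⟩
        simp only [hAdef, Finset.mem_sdiff, Finset.mem_filter, Finset.mem_univ, true_and, not_lt]
        exact ⟨by omega, (hB _ _ k (by simp; omega) (by omega)).symm⟩
    simpa [hcard'] using Finset.card_nsmul_le_sum _ _ _ this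

lemma two_mul_choose_two (m : ℕ) : 2 * m.choose 2 = m * (m - 1) := by
  rw [Nat.choose_two_right, Nat.mul_div_cancel' (Nat.even_mul_pred_self m).two_dvd]

lemma le_card_edgeSet_KcupM {c : ℕ} (hc : c ≤ n) :
    c.choose 2 + (n - c) / 2 ≤ Nat.card (KcupM n c).edgeSet := by
  have h := le_degSum_of_clique_of_pairs (H := KcupM n c) hc
    (fun i j hi hj hij => by
      rw [KcupM, SimpleGraph.fromRel_adj]
      exact ⟨hij, Or.inl (Or.inl ⟨hi, hj⟩)⟩)
    (fun i j k hi hj => by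
      rw [KcupM, SimpleGraph.fromRel_adj]
      exact ⟨fun h => by rw [h] at hi; omega, Or.inl (Or.inr (by omega))⟩)
  rw [degSum_univ] at h
  have := two_mul_choose_two c
  omega

lemma le_card_edgeSet_Fnp {p : ℕ} (hp : p ≤ n) :
    p.choose 2 + (n - p) * p + (n - p) / 2 ≤ Nat.card (Fnp n p).edgeSet := by
  have h := le_degSum_of_clique_of_pairs (H := Fnp n p) hp
    (fun i j hi hj hij => by
      rw [Fnp, SimpleGraph.fromRel_adj]
      exact ⟨hij, Or.inl (Or.inl hi)⟩)
    (fun i j k hi hj => by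
      rw [Fnp, SimpleGraph.fromRel_adj]
      exact ⟨fun h => by rw [h] at hi; omega, Or.inl (Or.inr (Or.inr (by omega)))⟩)
  have hcard := card_filter_val_lt hp
  have hcross : p * (n - p) ≤ ∑ a ∈ Finset.univ.filter (fun i : Fin n => i.val < p),
      degIn (Fnp n p) (Finset.univ \ Finset.univ.filter fun i : Fin n => i.val < p) a := by
    rw [← smul_eq_mul]
    nth_rw 1 [← hcard]
    refine Finset.card_nsmul_le_sum _ _ _ fun a ha => ?_
    have hsd : (Finset.univ \ Finset.univ.filter fun i : Fin n => i.val < p).card = n - p := by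
      rw [Finset.card_sdiff_of_subset (Finset.subset_univ _), hcard, Finset.card_fin]
    rw [← hsd]
    refine Finset.card_le_card fun b hb => Finset.mem_filter.2 ⟨hb, ?_⟩
    simp only [Finset.mem_sdiff, Finset.mem_filter, Finset.mem_univ, true_and] at ha hb
    rw [Fnp, SimpleGraph.fromRel_adj]
    exact ⟨fun h => hb (h ▸ ha), Or.inl (Or.inl ha)⟩
  rw [degSum_univ] at h
  have := two_mul_choose_two p
  rw [mul_comm (n - p) p]
  omega

/-- A set `A` together with a pairing of the remaining vertices gives an enumeration of all
vertices that starts with `A` and continues with the pairs. -/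
lemma exists_enumeration {G : SimpleGraph (Fin n)} {A : Finset (Fin n)}
    (h₁ : ∀ v ∈ Finset.univ \ A, degIn G (Finset.univ \ A) v ≤ 1)
    (h₂ : (Finset.univ \ A).card ≤ degSum G (Finset.univ \ A) + 1) :
    ∃ f : Fin n → Fin n, Function.Injective f ∧ (∀ i, f i ∈ A ↔ i.val < A.card) ∧
      ∀ i j : Fin n, ∀ k, i.val = A.card + 2 * k → j.val = A.card + 2 * k + 1 →
        G.Adj (f i) (f j) := by
  obtain ⟨L, hL, hLB, hadj⟩ := exists_list_pairs _ h₁ h₂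
  have hmem : ∀ z, z ∈ L ↔ z ∉ A := fun z => by rw [← List.mem_toFinset, hLB]; simp
  have hnodup : (A.toList ++ L).Nodup := by
    rw [List.nodup_append']
    exact ⟨A.nodup_toList, hL, fun z hz hz' => (hmem z).1 hz' (Finset.mem_toList.1 hz)⟩
  have hlen : (A.toList ++ L).length = n := by
    rw [← List.toFinset_card_of_nodup hnodup, List.toFinset_append, Finset.toList_toFinset, hLB,
      Finset.union_sdiff_of_subset (Finset.subset_univ A), Finset.card_fin]
  refine ⟨fun i => (A.toList ++ L)[i.val]'(by omega), fun i j hij => ?_, fun i => ?_, ?_⟩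
  · exact Fin.ext ((hnodup.getElem_inj_iff).1 hij)
  · rcases lt_or_ge i.val A.card with hi | hi
    · simp only [hi, iff_true]
      rw [List.getElem_append_left (by simpa using hi)]
      exact Finset.mem_toList.1 (List.getElem_mem _)
    · simp only [hi.not_gt, iff_false]
      rw [List.getElem_append_right (by simpa using hi)]
      exact (hmem _).1 (List.getElem_mem _)
  · intro i j k hi hj
    have hj' := j.isLt
    rw [List.length_append, Finset.length_toList] at hlen
    have := hadj k (by omega)
    simp only [hi, hj]
    rw [List.getElem_append_right (by simp), List.getElem_append_right (by simp; omega)]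
    simpa [add_assoc] using this

lemma iso_KcupM {G : SimpleGraph (Fin n)} {p : ℕ} (ht : CliqueType G Finset.univ p)
    (hc : Nat.card G.edgeSet = (3 * p + 2).choose 2 + (n - (3 * p + 2)) / 2) :
    Nonempty (G ≃g KcupM n (3 * p + 2)) := by
  obtain ⟨A, -, hA, hcross, hdeg⟩ := ht
  have hAn : A.card ≤ n := by simpa using Finset.card_le_univ A
  have hBcard : (Finset.univ \ A).card = n - A.card := by
    rw [Finset.card_sdiff_of_subset (Finset.subset_univ _), Finset.card_fin]
  have hsplit := degSum_split (G := G) (Finset.subset_univ A)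
  have hzero : ∑ a ∈ A, degIn G (Finset.univ \ A) a = 0 :=
    Finset.sum_eq_zero fun a ha => Finset.card_eq_zero.2
      (Finset.filter_eq_empty_iff.2 fun {b} hb => hcross a ha b hb)
  have hB : degSum G (Finset.univ \ A) ≤ (Finset.univ \ A).card := by
    simpa [degSum] using Finset.sum_le_card_nsmul _ _ 1 hdeg
  have hAle := degSum_le (G := G) A
  obtain ⟨x, hx⟩ := even_degSum (G := G) A
  obtain ⟨y, hy⟩ := even_degSum (G := G) (Finset.univ \ A)
  have hch := two_mul_choose_two A.card
  rw [← hA] at hc ⊢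
  rw [degSum_univ] at hsplit
  obtain ⟨f, hf, hfA, hpair⟩ := exists_enumeration (G := G) (A := A) hdeg (by omega)
  refine iso_of_injective_hom f hf (fun i j hij => ?_) (hc.trans_le (le_card_edgeSet_KcupM hAn))
  have hclique : ∀ i j : Fin n, i ≠ j → i.val < A.card → j.val < A.card → G.Adj (f i) (f j) :=
    fun i j hij hi hj => adj_of_degSum_eq (by omega) ((hfA i).2 hi) ((hfA j).2 hj) (hf.ne hij)
  rw [KcupM, SimpleGraph.fromRel_adj] at hij
  obtain ⟨hne, hij⟩ := hij
  have hne' : i.val ≠ j.val := fun h => hne (Fin.ext h)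
  by_cases hi : i.val < A.card
  · exact hclique i j hne hi (by omega)
  · rcases hne'.lt_or_gt with hlt | hlt
    · exact hpair i j ((i.val - A.card) / 2) (by omega) (by omega)
    · exact (hpair j i ((i.val - A.card) / 2) (by omega) (by omega)).symm

lemma iso_Fnp {G : SimpleGraph (Fin n)} {p : ℕ} (ht : HubType G Finset.univ p)
    (hc : Nat.card G.edgeSet = p.choose 2 + (n - p) * p + (n - p) / 2) :
    Nonempty (G ≃g Fnp n p) := by
  obtain ⟨A, -, rfl, hdeg⟩ := ht
  have hAn : A.card ≤ n := by simpa using Finset.card_le_univ A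
  have hBcard : (Finset.univ \ A).card = n - A.card := by
    rw [Finset.card_sdiff_of_subset (Finset.subset_univ _), Finset.card_fin]
  have hsplit := degSum_split (G := G) (Finset.subset_univ A)
  have hcr : ∑ a ∈ A, degIn G (Finset.univ \ A) a ≤ A.card * (Finset.univ \ A).card :=
    Finset.sum_le_card_nsmul _ _ _ fun a _ => Finset.card_filter_le _ _
  have hB : degSum G (Finset.univ \ A) ≤ (Finset.univ \ A).card := by
    simpa [degSum] using Finset.sum_le_card_nsmul _ _ 1 hdeg
  have hAle := degSum_le (G := G) A
  obtain ⟨x, hx⟩ := even_degSum (G := G) A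
  obtain ⟨y, hy⟩ := even_degSum (G := G) (Finset.univ \ A)
  have hch := two_mul_choose_two A.card
  have hc' := hc
  rw [mul_comm (n - A.card), ← hBcard] at hc'
  rw [degSum_univ] at hsplit
  generalize hM : A.card * (Finset.univ \ A).card = M at *
  obtain ⟨f, hf, hfA, hpair⟩ := exists_enumeration (G := G) (A := A) hdeg (by omega)
  refine iso_of_injective_hom f hf (fun i j hij => ?_) (hc.trans_le (le_card_edgeSet_Fnp hAn))
  have hhub : ∀ i j : Fin n, i ≠ j → i.val < A.card → G.Adj (f i) (f j) := by
    intro i j hij hi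
    by_cases hj : j.val < A.card
    · exact adj_of_degSum_eq (by omega) ((hfA i).2 hi) ((hfA j).2 hj) (hf.ne hij)
    · exact adj_of_sum_degIn_eq (B := Finset.univ \ A) (by omega) ((hfA i).2 hi)
        (by simp [hfA, hj])
  rw [Fnp, SimpleGraph.fromRel_adj] at hij
  obtain ⟨hne, hij⟩ := hij
  have hne' : i.val ≠ j.val := fun h => hne (Fin.ext h)
  by_cases hi : i.val < A.card
  · exact hhub i j hne hi
  by_cases hj : j.val < A.card
  · exact (hhub j i hne.symm hj).symm
  rcases hne'.lt_or_gt with hlt | hlt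
  · exact hpair i j ((i.val - A.card) / 2) (by omega) (by omega)
  · exact (hpair j i ((i.val - A.card) / 2) (by omega) (by omega)).symm

lemma containsLinearForest_of_hasPacking {G : SimpleGraph (Fin n)} {ℓ : ℕ}
    (h : HasPacking G Finset.univ ℓ) : ContainsLinearForest G (fun _ : Fin ℓ => 3) := by
  obtain ⟨𝒯, h𝒯, hcard⟩ := h
  let e : Fin ℓ ≃ 𝒯 := (𝒯.equivFinOfCardEq hcard).symm
  choose a b c hab hbc hac ht using fun i => h𝒯.path (e i).1 (e i).2
  have hmem : ∀ (i : Fin ℓ) (x : Fin 3), ![a i, b i, c i] x ∈ (e i).1 := by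
    intro i x
    rw [ht i]
    fin_cases x <;> simp
  refine ⟨fun i => ![a i, b i, c i], ?_, ?_⟩
  · rintro ⟨i, x⟩ ⟨j, y⟩ hxy
    change ![a i, b i, c i] x = ![a j, b j, c j] y at hxy
    have hij : i = j := by
      by_contra hne
      have hd := h𝒯.disj _ (e i).2 _ (e j).2 fun he => hne (e.injective (Subtype.ext he))
      exact Finset.disjoint_left.1 hd (hmem i x) (hxy ▸ hmem j y)
    subst hij
    have h₁ := (hab i).ne
    have h₂ := (hbc i).ne
    have h₃ := hac i
    have hx : x = y := by
      clear hmem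
      revert hxy
      fin_cases x <;> fin_cases y <;> simp [h₁, h₂, h₃, h₁.symm, h₂.symm, h₃.symm]
    rw [hx]
  · intro i x y hxy
    rw [SimpleGraph.pathGraph_adj] at hxy
    have h₁ := hab i
    have h₂ := hbc i
    fin_cases x <;> fin_cases y <;> simp_all [SimpleGraph.adj_comm]

end Extremal

theorem turan_number_P3_forest (ℓ : ℕ) (hℓ : 1 ≤ ℓ) (n : ℕ)
    (G : SimpleGraph (Fin n)) (hfree : ¬ ContainsLinearForest G (fun _ : Fin ℓ => 3)) :
    (n < 3 * ℓ →
      Nat.card G.edgeSet ≤ n.choose 2 ∧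
      (Nat.card G.edgeSet = n.choose 2 ↔ Nonempty (G ≃g (⊤ : SimpleGraph (Fin n))))) ∧
    (3 * ℓ ≤ n → n < 5 * ℓ - 1 →
      Nat.card G.edgeSet ≤ (3 * ℓ - 1).choose 2 + (n - 3 * ℓ + 1) / 2 ∧
      (Nat.card G.edgeSet = (3 * ℓ - 1).choose 2 + (n - 3 * ℓ + 1) / 2 ↔
        Nonempty (G ≃g KcupM n (3 * ℓ - 1)))) ∧
    (n = 5 * ℓ - 1 →
      Nat.card G.edgeSet ≤ (3 * ℓ - 1).choose 2 + ℓ ∧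
      (Nat.card G.edgeSet = (3 * ℓ - 1).choose 2 + ℓ ↔
        Nonempty (G ≃g KcupM n (3 * ℓ - 1)) ∨ Nonempty (G ≃g Fnp n (ℓ - 1)))) ∧
    (5 * ℓ - 1 < n →
      Nat.card G.edgeSet ≤ (ℓ - 1).choose 2 + (n - ℓ + 1) * (ℓ - 1) + (n - ℓ + 1) / 2 ∧
      (Nat.card G.edgeSet = (ℓ - 1).choose 2 + (n - ℓ + 1) * (ℓ - 1) + (n - ℓ + 1) / 2 ↔
        Nonempty (G ≃g Fnp n (ℓ - 1)))) := by

  obtain ⟨p, rfl⟩ : ∃ p, ℓ = p + 1 := ⟨ℓ - 1, by omega⟩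
  have hb := turanBound_of_not_hasPacking (G := G) Finset.univ p fun h =>
    hfree (containsLinearForest_of_hasPacking h)
  unfold TuranBound at hb
  rw [Finset.card_fin, degSum_univ] at hb
  have e₁ : 3 * (p + 1) - 1 = 3 * p + 2 := by omega
  have e₂ : n - (p + 1) + 1 = n - p ∨ n < p + 1 := by omega
  have hK : 2 * (3 * p + 2).choose 2 = 9 * p * p + 9 * p + 2 := by
    rw [two_mul_choose_two, show 3 * p + 2 - 1 = 3 * p + 1 by omega]
    ring
  rw [e₁, Nat.add_sub_cancel]
  have hF : p ≤ n → 2 * (p.choose 2 + (n - p) * p) + p * p + p = 2 * p * n := by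
    intro hpn
    obtain ⟨m, rfl⟩ := Nat.exists_eq_add_of_le hpn
    have := two_mul_choose_two p
    have hpp : p * (p - 1) + p = p * p := by
      rcases p with _ | p
      · rfl
      · rw [Nat.add_sub_cancel]; ring
    rw [Nat.add_sub_cancel_left]
    nlinarith
  refine ⟨fun _ => ?_, fun h₁ h₂ => ?_, fun h₁ => ?_, fun h₁ => ?_⟩
  · have htop : Nat.card (⊤ : SimpleGraph (Fin n)).edgeSet = n.choose 2 := by
      rw [Nat.card_eq_fintype_card, ← SimpleGraph.edgeFinset_card,
        SimpleGraph.card_edgeFinset_top_eq_card_choose_two, Fintype.card_fin]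
    rw [← htop]
    refine ⟨Set.ncard_le_ncard (SimpleGraph.edgeSet_mono le_top),
      fun h => ?_, card_edgeSet_eq_of_iso⟩
    rw [eq_of_le_of_card_edgeSet_le le_top h.ge]
    exact ⟨SimpleGraph.Iso.refl⟩
  · have h := hb.1 (by omega) (by omega)
    have hlow := le_card_edgeSet_KcupM (n := n) (c := 3 * p + 2) (by omega)
    rw [show n - 3 * (p + 1) + 1 = n - (3 * p + 2) by omega]
    generalize 9 * p * p = x at *
    have hle : Nat.card G.edgeSet ≤ (3 * p + 2).choose 2 + (n - (3 * p + 2)) / 2 := by omega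
    exact ⟨hle, fun he => iso_KcupM (h.2 (by omega)) he, fun hi =>
      hle.antisymm ((card_edgeSet_eq_of_iso hi).symm ▸ hlow)⟩
  · have h := hb.2 (by omega)
    have hn : n = 5 * p + 4 := by omega
    have hF' := hF (by omega)
    have e₃ : 2 * p * n = p * p + 9 * p * p + 8 * p := by rw [hn]; ring
    rw [e₃] at h hF'
    have hlow := le_card_edgeSet_KcupM (n := n) (c := 3 * p + 2) (by omega)
    have hlow' := le_card_edgeSet_Fnp (n := n) (p := p) (by omega)
    rw [show (n - (3 * p + 2)) / 2 = p + 1 by omega] at hlow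
    generalize hx : 9 * p * p = x at *
    generalize hy : p * p = y at *
    generalize hz : (n - p) * p = z at *
    have hle : Nat.card G.edgeSet ≤ (3 * p + 2).choose 2 + (p + 1) := by omega
    refine ⟨hle, fun he => ?_, ?_⟩
    · rcases h.2 (by omega) with ht | ⟨-, ht⟩
      · exact Or.inr (iso_Fnp ht (by omega))
      · exact Or.inl (iso_KcupM ht (by omega))
    · rintro (hi | hi)
      · exact hle.antisymm ((card_edgeSet_eq_of_iso hi).symm ▸ hlow)
      · have := card_edgeSet_eq_of_iso hi
        omega
  · have h := hb.2 (by omega)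
    have hF' := hF (by omega)
    have hlow := le_card_edgeSet_Fnp (n := n) (p := p) (by omega)
    rw [e₂.resolve_right (by omega)]
    generalize 2 * p * n = x at *
    generalize p * p = y at *
    have hle : Nat.card G.edgeSet ≤ p.choose 2 + (n - p) * p + (n - p) / 2 := by omega
    refine ⟨hle, fun he => ?_, fun hi =>
      hle.antisymm ((card_edgeSet_eq_of_iso hi).symm ▸ hlow)⟩
    exact iso_Fnp ((h.2 (by omega)).resolve_right fun hc => by omega) he
end

section
/- Let F_ℓ = P_{k_1} ∪ ⋯ ∪ P_{k_ℓ} be a linear forest with ℓ ≥ 1, k_1 ≥ ⋯ ≥ k_ℓ ≥ 2, and p = (∑_{i=1}^{ℓ} ⌊k_i/2⌋) − 1 ≥ 1, and let α ∈ (0,1). Then for every δ > 0 there exists N such that for all n ≥ N: if G is a connected F_ℓ-free simple graph on n vertices with ρ_α(G) ≥ ρ_α(S_{n,p}), then there exists a set A of p vertices of G such that the closed common neighborhood N[A] = A ∪ {v : v is adjacent to every vertex of A} satisfies |N[A]| > (1 − δ)n. -/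
open SimpleGraph
open scoped Classical

/-- A sequence of distinct, consecutively adjacent vertices contains every linear
forest on that many vertices. -/
theorem containsLinearForest_of_path {V : Type*} (G : SimpleGraph V) {ℓ : ℕ} (k : Fin ℓ → ℕ)
    (f : ℕ → V) (hinj : Set.InjOn f (Set.Iio (∑ i, k i)))
    (hadj : ∀ i, i + 1 < ∑ i, k i → G.Adj (f i) (f (i + 1))) : ContainsLinearForest G k := by
  refine ⟨fun i a => f (finSigmaFinEquiv ⟨i, a⟩ : Fin (∑ i, k i)), ?_, ?_⟩
  · intro q q' h
    exact finSigmaFinEquiv.injective (Fin.ext (hinj (Fin.isLt _) (Fin.isLt _) h))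
  · have key : ∀ (i : Fin ℓ) (a b : Fin (k i)), (a : ℕ) + 1 = b →
        G.Adj (f (finSigmaFinEquiv ⟨i, a⟩ : Fin (∑ i, k i)))
          (f (finSigmaFinEquiv ⟨i, b⟩ : Fin (∑ i, k i))) := by
      intro i a b hab
      have h : ((finSigmaFinEquiv ⟨i, b⟩ : Fin (∑ i, k i)) : ℕ)
          = (finSigmaFinEquiv ⟨i, a⟩ : Fin (∑ i, k i)) + 1 := by
        rw [finSigmaFinEquiv_apply, finSigmaFinEquiv_apply]
        simp only
        omega
      have hlt := (finSigmaFinEquiv ⟨i, b⟩ : Fin (∑ i, k i)).isLt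
      rw [h] at hlt ⊢
      exact hadj _ hlt
    intro i a b hab
    rcases SimpleGraph.pathGraph_adj.1 hab with h | h
    · exact key i a b h
    · exact (key i b a h).symm

/-- If every vertex of a nonempty set `S` has at least `K` neighbours in `S`, then `S` contains
a path on `K` vertices. -/
theorem exists_path_of_forall_le_card_neighbors {V : Type*} (G : SimpleGraph V)
    (K : ℕ) (S : Finset V) (hS : S.Nonempty)
    (hdeg : ∀ v ∈ S, K ≤ (S.filter fun w => G.Adj v w).card) :
    ∃ f : ℕ → V, Set.InjOn f (Set.Iio K) ∧ ∀ i, i + 1 < K → G.Adj (f i) (f (i + 1)) := by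
  have key : ∀ j, j + 1 ≤ K → ∃ f : ℕ → V, f j ∈ S ∧ Set.InjOn f (Set.Iio (j + 1)) ∧
      ∀ i, i + 1 < j + 1 → G.Adj (f i) (f (i + 1)) := by
    intro j
    induction j with
    | zero =>
      intro _
      obtain ⟨v, hv⟩ := hS
      refine ⟨fun _ => v, hv, ?_, fun i hi => by omega⟩
      intro a ha b hb _
      simp only [Set.mem_Iio] at ha hb
      omega
    | succ j ih =>
      intro hj
      obtain ⟨f, hf, hinj, hadj⟩ := ih (by omega)
      have hcard : ((Finset.range (j + 1)).image f).card
          < (S.filter fun w => G.Adj (f j) w).card :=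
        lt_of_le_of_lt Finset.card_image_le
          (by rw [Finset.card_range]; exact lt_of_lt_of_le (by omega) (hdeg _ hf))
      obtain ⟨w, hw, hw'⟩ := Finset.exists_mem_notMem_of_card_lt_card hcard
      rw [Finset.mem_filter] at hw
      have hne : ∀ i, i < j + 1 → f i ≠ w := fun i hi h =>
        hw' (Finset.mem_image.2 ⟨i, Finset.mem_range.2 hi, h⟩)
      refine ⟨Function.update f (j + 1) w, by simpa using hw.1, ?_, ?_⟩
      · intro a ha b hb hab
        simp only [Set.mem_Iio] at ha hb
        simp only [Function.update_apply] at hab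
        split_ifs at hab with h1 h2 h2
        · omega
        · exact absurd hab.symm (hne b (by omega))
        · exact absurd hab (hne a (by omega))
        · exact hinj (Set.mem_Iio.2 (by omega)) (Set.mem_Iio.2 (by omega)) hab
      · intro i hi
        simp only [Function.update_apply]
        rw [if_neg (by omega)]
        split_ifs with h
        · obtain rfl : i = j := by omega
          exact hw.2
        · exact hadj i (by omega)
  rcases K with _ | K
  · obtain ⟨v, -⟩ := hS
    exact ⟨fun _ => v, fun a ha => by simp at ha, fun i hi => by omega⟩
  · obtain ⟨f, -, h1, h2⟩ := key K le_rfl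
    exact ⟨f, h1, h2⟩

/-- A graph without a path on `K` vertices spans at most `K * |S|` edges on any set `S`. -/
theorem sum_card_neighbors_le {V : Type*} (G : SimpleGraph V) (K : ℕ)
    (hG : ¬ ∃ f : ℕ → V, Set.InjOn f (Set.Iio K) ∧ ∀ i, i + 1 < K → G.Adj (f i) (f (i + 1)))
    (S : Finset V) :
    ∑ v ∈ S, (S.filter fun w => G.Adj v w).card ≤ 2 * K * S.card := by
  induction S using Finset.strongInduction with
  | H S ih =>
    rcases S.eq_empty_or_nonempty with rfl | hS
    · simp
    obtain ⟨v, hv, hlt⟩ : ∃ v ∈ S, (S.filter fun w => G.Adj v w).card < K := by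
      by_contra! h
      exact hG (exists_path_of_forall_le_card_neighbors G K S hS h)
    have h := ih (S.erase v) (Finset.erase_ssubset hv)
    obtain ⟨T, hvT, rfl⟩ : ∃ T, v ∉ T ∧ S = insert v T :=
      ⟨S.erase v, Finset.notMem_erase v S, (Finset.insert_erase hv).symm⟩
    rw [Finset.erase_insert hvT] at h
    simp only [Finset.card_filter, Finset.sum_insert hvT, Finset.sum_add_distrib,
      Finset.card_insert_of_notMem hvT, SimpleGraph.irrefl, if_false, zero_add] at h hlt ⊢
    simp only [fun x => G.adj_comm x v]
    nlinarith

theorem adjMat_nonneg {n : ℕ} (G : SimpleGraph (Fin n)) (i j : Fin n) : 0 ≤ adjMat G i j := by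
  simp only [adjMat, Matrix.of_apply]; split_ifs <;> norm_num

theorem adjMat_le_one {n : ℕ} (G : SimpleGraph (Fin n)) (i j : Fin n) : adjMat G i j ≤ 1 := by
  simp only [adjMat, Matrix.of_apply]; split_ifs <;> norm_num

theorem adjMat_comm {n : ℕ} (G : SimpleGraph (Fin n)) (i j : Fin n) :
    adjMat G i j = adjMat G j i := by
  simp only [adjMat, Matrix.of_apply, G.adj_comm i j]

theorem adjMat_self {n : ℕ} (G : SimpleGraph (Fin n)) (i : Fin n) : adjMat G i i = 0 := by
  simp [adjMat]

/-- The degree, as it appears in the degree matrix, is a row sum of the adjacency matrix. -/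
theorem natCard_adj_eq_sum {n : ℕ} (G : SimpleGraph (Fin n)) (i : Fin n) :
    (Nat.card {j // G.Adj i j} : ℝ) = ∑ j, adjMat G i j := by
  simp [adjMat, Nat.card_eq_fintype_card, Fintype.card_subtype]

theorem sum_adjMat_le {n : ℕ} (G : SimpleGraph (Fin n)) {ℓ : ℕ} (k : Fin ℓ → ℕ)
    (hG : ¬ ContainsLinearForest G k) :
    ∑ i, ∑ j, adjMat G i j ≤ 2 * ((∑ i, k i : ℕ) : ℝ) * n := by
  have h := sum_card_neighbors_le G (∑ i, k i)
    (fun ⟨f, h1, h2⟩ => hG (containsLinearForest_of_path G k f h1 h2)) Finset.univ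
  simp only [Finset.card_univ, Fintype.card_fin] at h
  have h' : ((∑ v, (Finset.univ.filter fun w => G.Adj v w).card : ℕ) : ℝ)
      ≤ ((2 * (∑ i, k i) * n : ℕ) : ℝ) := Nat.cast_le.2 h
  rw [Nat.cast_sum, Nat.cast_mul, Nat.cast_mul] at h'
  simpa [adjMat] using h'

theorem alphaMat_mulVec {n : ℕ} (G : SimpleGraph (Fin n)) (α : ℝ) (x : Fin n → ℝ) (i : Fin n) :
    ((α • degMat G + (1 - α) • adjMat G).mulVec x) i
      = α * (∑ j, adjMat G i j) * x i + (1 - α) * ∑ j, adjMat G i j * x j := by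
  rw [Matrix.add_mulVec, Matrix.smul_mulVec, Matrix.smul_mulVec, degMat, Pi.add_apply,
    Pi.smul_apply, Pi.smul_apply, Matrix.mulVec_diagonal, natCard_adj_eq_sum, Matrix.mulVec,
    dotProduct, smul_eq_mul, smul_eq_mul, mul_assoc]

theorem alphaMat_isHermitian {n : ℕ} (G : SimpleGraph (Fin n)) (α : ℝ) :
    (α • degMat G + (1 - α) • adjMat G).IsHermitian := by
  apply Matrix.IsHermitian.ext
  intro i j
  simp only [degMat, adjMat, Matrix.add_apply, Matrix.smul_apply, Matrix.of_apply, G.adj_comm i j,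
    star_trivial, smul_eq_mul, Matrix.diagonal_apply]
  by_cases h : i = j
  · subst h; rfl
  · rw [if_neg h, if_neg (Ne.symm h)]

/-- `specRad` bounds every eigenvalue from above. -/
theorem le_specRad {n : ℕ} (M : Matrix (Fin n) (Fin n) ℝ) (μ : ℝ) (x : Fin n → ℝ) (hx : x ≠ 0)
    (h : M.mulVec x = μ • x) : μ ≤ specRad M := by
  refine le_csSup (Matrix.finite_real_spectrum (𝕜 := ℝ)).bddAbove ?_
  rw [← Matrix.spectrum_toLin', ← Module.End.hasEigenvalue_iff_mem_spectrum]
  refine Module.End.hasEigenvalue_of_hasEigenvector (x := x) ⟨?_, hx⟩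
  rw [Module.End.mem_eigenspace_iff, Matrix.toLin'_apply, h]

/-- For a symmetric matrix, `specRad` is attained at an eigenvector. -/
theorem exists_eigenvector_specRad {n : ℕ} [NeZero n] (M : Matrix (Fin n) (Fin n) ℝ)
    (hM : M.IsHermitian) : ∃ x : Fin n → ℝ, x ≠ 0 ∧ M.mulVec x = specRad M • x := by
  have hmem : specRad M ∈ spectrum ℝ M := by
    refine Set.Nonempty.csSup_mem ?_ (Matrix.finite_real_spectrum (𝕜 := ℝ))
    rw [hM.spectrum_real_eq_range_eigenvalues]
    exact Set.range_nonempty _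
  rw [← Matrix.spectrum_toLin', ← Module.End.hasEigenvalue_iff_mem_spectrum] at hmem
  obtain ⟨x, hx⟩ := hmem.exists_hasEigenvector
  refine ⟨x, hx.2, ?_⟩
  have := hx.1
  rwa [Module.End.mem_eigenspace_iff, Matrix.toLin'_apply] at this

/-- The absolute values of a top eigenvector, normalised to have maximum `1`, form a
subsolution of the eigenvalue equation. -/
theorem exists_normalized_subsolution {n : ℕ} [NeZero n] (G : SimpleGraph (Fin n)) (α : ℝ)
    (h0 : 0 < α) (h1 : α < 1) (hr : 0 ≤ rhoAlpha α G) :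
    ∃ (y : Fin n → ℝ) (u : Fin n), (∀ i, 0 ≤ y i) ∧ (∀ i, y i ≤ 1) ∧ y u = 1 ∧
      ∀ i, rhoAlpha α G * y i
        ≤ α * (∑ j, adjMat G i j) * y i + (1 - α) * ∑ j, adjMat G i j * y j := by
  obtain ⟨x, hx, hev⟩ := exists_eigenvector_specRad _ (alphaMat_isHermitian G α)
  obtain ⟨u, hu⟩ := Finite.exists_max fun i => |x i|
  have hpos : 0 < |x u| := by
    obtain ⟨i, hi⟩ := Function.ne_iff.1 hx
    exact (abs_pos.2 hi).trans_le (hu i)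
  refine ⟨fun i => |x i| / |x u|, u, fun i => by positivity,
    fun i => (div_le_one hpos).2 (hu i), div_self hpos.ne', fun i => ?_⟩
  have hi := congrFun hev i
  rw [alphaMat_mulVec, Pi.smul_apply, smul_eq_mul] at hi
  have hle : rhoAlpha α G * |x i|
      ≤ α * (∑ j, adjMat G i j) * |x i| + (1 - α) * ∑ j, adjMat G i j * |x j| := by
    calc rhoAlpha α G * |x i| = |rhoAlpha α G * x i| := by rw [abs_mul, abs_of_nonneg hr]
      _ = |α * (∑ j, adjMat G i j) * x i + (1 - α) * ∑ j, adjMat G i j * x j| := by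
        rw [rhoAlpha, ← hi]
      _ ≤ |α * (∑ j, adjMat G i j) * x i| + |(1 - α) * ∑ j, adjMat G i j * x j| :=
        abs_add_le _ _
      _ ≤ _ := by
        rw [abs_mul, abs_mul, abs_mul, abs_of_pos h0, abs_of_pos (sub_pos.2 h1),
          abs_of_nonneg (Finset.sum_nonneg fun j _ => adjMat_nonneg G i j)]
        gcongr
        refine (Finset.abs_sum_le_sum_abs _ _).trans_eq (Finset.sum_congr rfl fun j _ => ?_)
        rw [abs_mul, abs_of_nonneg (adjMat_nonneg G i j)]
  have hsum : ∑ j, adjMat G i j * (|x j| / |x u|) = (∑ j, adjMat G i j * |x j|) / |x u| := by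
    rw [Finset.sum_div]
    exact Finset.sum_congr rfl fun j _ => by ring
  simp only [hsum]
  have := div_le_div_of_nonneg_right hle hpos.le
  rw [add_div] at this
  simpa only [mul_div_assoc] using this

/-- The two-block eigenvector of `S_{n,p}`. -/
theorem le_rhoAlpha_Snp (n p : ℕ) (hp : 1 ≤ p) (hpn : p ≤ n) (α μ : ℝ) (hμp : α * p < μ)
    (hμ : (μ - (α * (n - 1) + (1 - α) * (p - 1))) * (μ - α * p)
      = (1 - α) ^ 2 * p * (n - p)) :
    μ ≤ rhoAlpha α (Snp n p) := by
  have hpos : 0 < μ - α * p := sub_pos.2 hμp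
  set t : ℝ := (1 - α) * p / (μ - α * p) with ht
  have htμ : t * (μ - α * p) = (1 - α) * p := div_mul_cancel₀ _ hpos.ne'
  have hμt : μ - (α * (n - 1) + (1 - α) * (p - 1)) = (1 - α) * (n - p) * t := by
    rw [ht, mul_div_assoc', eq_div_iff hpos.ne', hμ]; ring
  have hadj : ∀ i j : Fin n, adjMat (Snp n p) i j
      = (if i.val < p ∨ j.val < p then (1 : ℝ) else 0)
        - if i = j then (if i.val < p then (1 : ℝ) else 0) else 0 := by
    intro i j
    simp only [adjMat, Snp, Matrix.of_apply, SimpleGraph.fromRel_adj]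
    by_cases hij : i = j
    · subst hij; simp
    · simp [hij, or_comm]
  have hcount : ∑ j : Fin n, (if j.val < p then (1 : ℝ) else 0) = p := by
    rw [Fin.sum_univ_eq_sum_range (fun j => if j < p then (1 : ℝ) else 0) n,
      ← Finset.sum_filter]
    have : (Finset.range n).filter (fun j => j < p) = Finset.range p := by
      ext j; simp only [Finset.mem_filter, Finset.mem_range]; omega
    simp [this]
  have hcount' : ∑ j : Fin n, (if j.val < p then (1 : ℝ) else t) = p + (n - p) * t := by
    have : ∀ j : Fin n, (if j.val < p then (1 : ℝ) else t)
        = t + (1 - t) * (if j.val < p then (1 : ℝ) else 0) := fun j => by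
      split_ifs <;> ring
    simp only [this, Finset.sum_add_distrib, ← Finset.mul_sum, hcount]
    simp; ring
  refine le_specRad _ μ (fun i => if i.val < p then 1 else t) ?_ ?_
  · exact Function.ne_iff.2 ⟨⟨0, by omega⟩, by simp [show 0 < p by omega]⟩
  · ext i
    rw [alphaMat_mulVec]
    simp only [hadj, sub_mul, Finset.sum_sub_distrib, Finset.sum_ite_eq, Finset.mem_univ, if_true,
      ite_mul, zero_mul, one_mul, Pi.smul_apply, smul_eq_mul]
    by_cases hi : i.val < p
    · simp only [hi, true_or, if_true, hcount']
      simp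
      linear_combination -hμt
    · simp only [hi, false_or, if_false, hcount]
      have : ∑ j : Fin n, (if j.val < p then (if j.val < p then (1 : ℝ) else t) else 0) = p := by
        rw [← hcount]
        exact Finset.sum_congr rfl fun j _ => by split_ifs <;> rfl
      simp [this]
      linear_combination -htμ

theorem rhoAlpha_Snp_lower (n p : ℕ) (hp : 1 ≤ p) (hpn : p ≤ n) (α s : ℝ)
    (hs : α * p < s)
    (hs' : (s - (α * (n - 1) + (1 - α) * (p - 1))) * (s - α * p)
      ≤ (1 - α) ^ 2 * p * (n - p)) :
    s ≤ rhoAlpha α (Snp n p) := by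
  set a : ℝ := α * (n - 1) + (1 - α) * (p - 1) with ha
  set b : ℝ := (1 - α) ^ 2 * p * (n - p) with hb
  have hb0 : 0 ≤ b := by
    have : (0 : ℝ) ≤ n - p := sub_nonneg.2 (Nat.cast_le.2 hpn)
    positivity
  set L : ℝ := max s a + b + 1 with hL
  have hsL : s ≤ L := by linarith [le_max_left s a]
  have hup : b ≤ (L - a) * (L - α * p) := by
    have h1 : b + 1 ≤ L - a := by linarith [le_max_right s a]
    have h2 : 1 ≤ L - α * p := by linarith [le_max_left s a]
    nlinarith
  have hcont : ContinuousOn (fun x : ℝ => (x - a) * (x - α * p)) (Set.Icc s L) := by fun_prop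
  obtain ⟨μ, hμ, hμe⟩ := intermediate_value_Icc hsL hcont ⟨hs', hup⟩
  exact hμ.1.trans (le_rhoAlpha_Snp n p hp hpn α μ (hs.trans_le hμ.1) hμe)

/-- In a sparse graph whose `A_α`-eigenvalue equation has a normalised subsolution with a large
enough eigenvalue, at least `p` vertices are adjacent to almost all others. -/
theorem le_card_highDegree {n p : ℕ} (hp : 1 ≤ p) (G : SimpleGraph (Fin n)) (α θ C r B D : ℝ)
    (h0 : 0 < α) (h1 : α < 1) (hθ : 0 < θ) (hC : 0 ≤ C)
    (hB : B = 4 / α + 2) (hD : D = 2 * (B * C) / (α * θ))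
    (hdeg : ∑ i, ∑ j, adjMat G i j ≤ C * n)
    (hr : α * (n - 1) + (1 - α) * (p - 1) + (1 - α) ^ 2 * p / α - (1 - α) / 2 ≤ r)
    (hn1 : 4 < α * θ * n) (hn2 : 8 < α * n) (hn3 : D < n)
    (hn4 : D * C + 2 * (1 / 2 + (1 - α) * p / α) < (α / 2 + (1 - α)) * n)
    (y : Fin n → ℝ) (u : Fin n) (hy0 : ∀ i, 0 ≤ y i) (hy1 : ∀ i, y i ≤ 1) (hu : y u = 1)
    (hy : ∀ i, r * y i ≤ α * (∑ j, adjMat G i j) * y i + (1 - α) * ∑ j, adjMat G i j * y j) :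
    p ≤ (Finset.univ.filter fun v => (1 - θ) * (n : ℝ) < ∑ j, adjMat G v j).card := by
  set d : Fin n → ℝ := fun i => ∑ j, adjMat G i j with hd
  change ∑ i, d i ≤ C * n at hdeg
  change ∀ i, r * y i ≤ α * d i * y i + (1 - α) * ∑ j, adjMat G i j * y j at hy
  change p ≤ (Finset.univ.filter fun v => (1 - θ) * (n : ℝ) < d v).card
  have hα' : 0 < 1 - α := sub_pos.2 h1
  have hp' : (1 : ℝ) ≤ p := by exact_mod_cast hp
  have hn0 : (0 : ℝ) < n := by
    by_contra! h
    nlinarith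
  have hd0 : ∀ i, 0 ≤ d i := fun i => Finset.sum_nonneg fun j _ => adjMat_nonneg G i j
  have hB0 : 0 < B := by rw [hB]; positivity
  have hD0 : 0 ≤ D := by rw [hD]; positivity
  have hnS : ∀ i, 0 ≤ ∑ j, adjMat G i j * y j := fun i =>
    Finset.sum_nonneg fun j _ => mul_nonneg (adjMat_nonneg G i j) (hy0 j)
  have hrn : α * n - 2 ≤ r := by
    have h2 : 0 ≤ (1 - α) ^ 2 * p / α := by positivity
    have h3 : 0 ≤ (1 - α) * (p - 1) := mul_nonneg hα'.le (by linarith)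
    nlinarith
  -- an entry is controlled by the neighbourhood sum when the degree is far from `n`
  have hlow : ∀ η, 4 ≤ α * η * n → ∀ i, d i ≤ (1 - η) * n →
      α * η * n / 2 * y i ≤ ∑ j, adjMat G i j * y j := by
    intro η hη i hi
    have h2 : α * d i ≤ α * ((1 - η) * n) := mul_le_mul_of_nonneg_left hi h0.le
    have h3 : α * η * n / 2 ≤ r - α * d i := by nlinarith
    have h4 := mul_le_mul_of_nonneg_right h3 (hy0 i)
    nlinarith [hy i, hnS i, mul_nonneg h0.le (hnS i)]
  have hentry : ∀ i, y i * n ≤ B * d i := by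
    intro i
    rcases le_total (d i) ((1 - 1 / 2) * n) with h | h
    · have h2 := hlow (1 / 2) (by linarith) i h
      have h3 : ∑ j, adjMat G i j * y j ≤ d i := Finset.sum_le_sum fun j _ =>
        mul_le_of_le_one_right (adjMat_nonneg G i j) (hy1 j)
      have h4 : y i * n ≤ 4 / α * d i := by
        rw [div_mul_eq_mul_div, le_div_iff₀ h0]
        nlinarith
      rw [hB, add_mul]
      linarith [hd0 i]
    · have h2 : y i * n ≤ n := mul_le_of_le_one_left hn0.le (hy1 i)
      have h3 : 0 ≤ 4 / α * d i := mul_nonneg (by positivity) (hd0 i)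
      rw [hB, add_mul]
      linarith
  have hS : ∑ i, y i ≤ B * C := by
    refine le_of_mul_le_mul_right ?_ hn0
    calc (∑ i, y i) * n = ∑ i, y i * n := Finset.sum_mul _ _ _
      _ ≤ ∑ i, B * d i := Finset.sum_le_sum fun i _ => hentry i
      _ = B * ∑ i, d i := (Finset.mul_sum _ _ _).symm
      _ ≤ B * (C * n) := mul_le_mul_of_nonneg_left hdeg hB0.le
      _ = B * C * n := by ring
  have hsmall : ∀ i, d i ≤ (1 - θ) * n → y i * n ≤ D := by
    intro i hi
    have h2 := hlow θ hn1.le i hi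
    have h3 : ∑ j, adjMat G i j * y j ≤ ∑ j, y j := Finset.sum_le_sum fun j _ =>
      mul_le_of_le_one_left (hy0 j) (adjMat_le_one G i j)
    rw [hD, le_div_iff₀ (by positivity)]
    nlinarith
  set T : Finset (Fin n) := Finset.univ.filter fun v => (1 - θ) * (n : ℝ) < d v with hT
  have hmemT : ∀ i, i ∉ T → d i ≤ (1 - θ) * n := fun i hi => by simpa [hT] using hi
  have huT : u ∈ T := by
    by_contra h
    have := hsmall u (hmemT u h)
    rw [hu] at this
    linarith
  by_contra! hlt
  have hTp : (T.card : ℝ) ≤ p - 1 := by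
    have : ((T.card + 1 : ℕ) : ℝ) ≤ p := Nat.cast_le.2 hlt
    push_cast at this
    linarith
  have hdn : ∀ i, d i ≤ n - 1 := by
    intro i
    have h2 : d i ≤ ∑ j, (1 - if i = j then (1 : ℝ) else 0) := by
      refine Finset.sum_le_sum fun j _ => ?_
      split_ifs with h
      · rw [← h, adjMat_self]; norm_num
      · linarith [adjMat_le_one G i j]
    simpa using h2
  set W : ℝ := ∑ i ∈ Tᶜ, y i with hW
  have hTsum : ∑ i ∈ T, y i ≤ T.card := by
    simpa using Finset.sum_le_sum fun i (_ : i ∈ T) => hy1 i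
  have hsplit : ∑ i, y i = ∑ i ∈ T, y i + W := (Finset.sum_add_sum_compl T y).symm
  have hSu : ∑ j, adjMat G u j * y j ≤ (p - 2) + W := by
    have h2 : ∑ j, adjMat G u j * y j ≤ ∑ j, (y j - if u = j then (1 : ℝ) else 0) := by
      refine Finset.sum_le_sum fun j _ => ?_
      split_ifs with h
      · rw [← h, adjMat_self, hu]; norm_num
      · linarith [mul_le_of_le_one_left (hy0 j) (adjMat_le_one G u j)]
    rw [Finset.sum_sub_distrib, Finset.sum_ite_eq, if_pos (Finset.mem_univ u)] at h2
    linarith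
  have hru : r ≤ α * (n - 1) + (1 - α) * ((p - 2) + W) := by
    have h2 := hy u
    rw [hu, mul_one, mul_one] at h2
    have h3 := mul_le_mul_of_nonneg_left hSu hα'.le
    have h4 := mul_le_mul_of_nonneg_left (hdn u) h0.le
    linarith
  have hWlow : 1 / 2 + (1 - α) * p / α ≤ W := by
    refine le_of_mul_le_mul_left ?_ hα'
    have : (1 - α) * (1 / 2 + (1 - α) * p / α) = (1 - α) / 2 + (1 - α) ^ 2 * p / α := by ring
    rw [this]
    linarith
  have hcompl : ∑ i ∈ Tᶜ, d i * y i ≤ D * C := by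
    refine le_of_mul_le_mul_right ?_ hn0
    calc (∑ i ∈ Tᶜ, d i * y i) * n = ∑ i ∈ Tᶜ, d i * (y i * n) := by
          rw [Finset.sum_mul]; exact Finset.sum_congr rfl fun i _ => by ring
      _ ≤ ∑ i ∈ Tᶜ, d i * D := Finset.sum_le_sum fun i hi =>
          mul_le_mul_of_nonneg_left (hsmall i (hmemT i (Finset.mem_compl.1 hi))) (hd0 i)
      _ = (∑ i ∈ Tᶜ, d i) * D := (Finset.sum_mul _ _ _).symm
      _ ≤ (∑ i, d i) * D := mul_le_mul_of_nonneg_right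
          (Finset.sum_le_univ_sum_of_nonneg hd0) hD0
      _ ≤ (C * n) * D := mul_le_mul_of_nonneg_right hdeg hD0
      _ = D * C * n := by ring
  have hTd : ∑ i ∈ T, d i * y i ≤ (p - 1) * n := by
    calc ∑ i ∈ T, d i * y i ≤ ∑ i ∈ T, (n : ℝ) := Finset.sum_le_sum fun i _ =>
          (mul_le_of_le_one_right (hd0 i) (hy1 i)).trans (by linarith [hdn i])
      _ = T.card * n := by simp
      _ ≤ (p - 1) * n := mul_le_mul_of_nonneg_right hTp hn0.le
  have hdouble : ∑ i, ∑ j, adjMat G i j * y j = ∑ i, d i * y i := by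
    rw [Finset.sum_comm]
    refine Finset.sum_congr rfl fun j _ => ?_
    rw [hd, Finset.sum_mul]
    exact Finset.sum_congr rfl fun i _ => by rw [adjMat_comm]
  have hrW : r * W ≤ D * C + (1 - α) * ((p - 1) * n) := by
    have h2 : r * W ≤ α * ∑ i ∈ Tᶜ, d i * y i + (1 - α) * ∑ i ∈ Tᶜ, ∑ j, adjMat G i j * y j := by
      rw [hW, Finset.mul_sum, Finset.mul_sum, Finset.mul_sum, ← Finset.sum_add_distrib]
      refine Finset.sum_le_sum fun i _ => ?_
      rw [← mul_assoc]
      exact hy i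
    have h3 : ∑ i ∈ Tᶜ, ∑ j, adjMat G i j * y j ≤ ∑ i, d i * y i :=
      (Finset.sum_le_univ_sum_of_nonneg hnS).trans_eq hdouble
    rw [← Finset.sum_add_sum_compl T] at h3
    have h4 := mul_le_mul_of_nonneg_left (h3.trans (add_le_add_left hTd _)) hα'.le
    linarith
  have hfin : (α * n - 2) * (1 / 2 + (1 - α) * p / α) ≤ D * C + (1 - α) * ((p - 1) * n) := by
    refine le_trans ?_ hrW
    have h2 : 0 ≤ 1 / 2 + (1 - α) * p / α := by positivity
    exact mul_le_mul hrn hWlow h2 (by linarith)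
  have hexp : α * n * (1 / 2 + (1 - α) * p / α) = α / 2 * n + (1 - α) * (p * n) := by
    field_simp
  linarith

/-- Finitely many vertices of degree more than `(1 - δ / p) n` have more than `(1 - δ) n` common
neighbours. -/
theorem lt_ncard_commonNeighbors {n p : ℕ} (hp : 1 ≤ p) (G : SimpleGraph (Fin n)) (δ : ℝ)
    (A : Finset (Fin n)) (hA : A.card = p)
    (hdeg : ∀ a ∈ A, (1 - δ / p) * (n : ℝ) < ∑ j, adjMat G a j) :
    (1 - δ) * (n : ℝ) < (((A : Set (Fin n)) ∪ {v : Fin n | ∀ a ∈ A, G.Adj v a}).ncard : ℝ) := by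
  have hp' : (0 : ℝ) < p := by exact_mod_cast hp
  have hne : A.Nonempty := Finset.card_pos.1 (by omega)
  set R : Finset (Fin n) := Finset.univ.filter fun v => ∀ a ∈ A, G.Adj v a with hR
  have hle : R.card ≤ ((A : Set (Fin n)) ∪ {v : Fin n | ∀ a ∈ A, G.Adj v a}).ncard := by
    rw [← Set.ncard_coe_finset]
    refine Set.ncard_le_ncard (fun v hv => Or.inr ?_) (Set.toFinite _)
    simpa [hR] using hv
  refine lt_of_lt_of_le ?_ (Nat.cast_le.2 hle)
  have hcover : (n : ℝ) ≤ R.card + ∑ a ∈ A, ∑ j, (1 - adjMat G a j) := by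
    have h : ∀ v, (1 : ℝ) ≤ (if v ∈ R then 1 else 0) + ∑ a ∈ A, (1 - adjMat G a v) := by
      intro v
      have hnn : ∀ a ∈ A, (0 : ℝ) ≤ 1 - adjMat G a v := fun a _ =>
        sub_nonneg.2 (adjMat_le_one G a v)
      split_ifs with hv
      · linarith [Finset.sum_nonneg hnn]
      · obtain ⟨a, ha, hav⟩ : ∃ a ∈ A, ¬ G.Adj v a := by simpa [hR] using hv
        have h2 := Finset.single_le_sum hnn ha
        have h3 : adjMat G a v = 0 := by
          rw [adjMat_comm]; simp [adjMat, hav]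
        rw [h3] at h2
        linarith
    have h' := Finset.sum_le_sum fun v (_ : v ∈ Finset.univ) => h v
    rw [Finset.sum_add_distrib, Finset.sum_comm] at h'
    simpa using h'
  have hlt : ∑ a ∈ A, ∑ j, (1 - adjMat G a j) < ∑ a ∈ A, δ / p * n := by
    refine Finset.sum_lt_sum_of_nonempty hne fun a ha => ?_
    rw [Finset.sum_sub_distrib]
    simp only [Finset.sum_const, Finset.card_univ, Fintype.card_fin, nsmul_eq_mul, mul_one]
    linarith [hdeg a ha]
  have hsum : ∑ a ∈ A, δ / p * (n : ℝ) = δ * n := by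
    rw [Finset.sum_const, hA, nsmul_eq_mul]
    field_simp
  linarith

theorem eventually_lt_mul_natCast (L s : ℝ) (hs : 0 < s) :
    ∀ᶠ n : ℕ in Filter.atTop, L < s * (n : ℝ) :=
  (tendsto_natCast_atTop_atTop.const_mul_atTop hs).eventually_gt_atTop L

theorem structure_of_extremal_linearForest_free (ℓ : ℕ) (hℓ : 1 ≤ ℓ) (k : Fin ℓ → ℕ) (hk : ∀ i, 2 ≤ k i) (hmono : Antitone k)
    (p : ℕ) (hp : p + 1 = ∑ i, k i / 2) (hp1 : 1 ≤ p)
    (α : ℝ) (hα : α ∈ Set.Ioo (0 : ℝ) 1) :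
    ∀ δ : ℝ, 0 < δ → ∃ N : ℕ, ∀ n : ℕ, N ≤ n → ∀ G : SimpleGraph (Fin n),
      G.Connected → ¬ ContainsLinearForest G k → rhoAlpha α (Snp n p) ≤ rhoAlpha α G →
      ∃ A : Finset (Fin n), A.card = p ∧
        (1 - δ) * (n : ℝ) <
          (((A : Set (Fin n)) ∪ {v : Fin n | ∀ a ∈ A, G.Adj v a}).ncard : ℝ) := by
  intro δ hδ
  obtain ⟨h0, h1⟩ := hα
  have hα' : 0 < 1 - α := sub_pos.2 h1
  have hp' : (0 : ℝ) < p := by exact_mod_cast hp1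
  have hθ : 0 < δ / p := div_pos hδ hp'
  set C : ℝ := 2 * ((∑ i, k i : ℕ) : ℝ) with hC
  set B : ℝ := 4 / α + 2 with hB
  set D : ℝ := 2 * (B * C) / (α * (δ / p)) with hD
  set c : ℝ := (1 - α) ^ 2 * p / α with hc
  -- `α n + e` is a lower bound for the spectral radius of `S_{n,p}`
  set e : ℝ := -α + (1 - α) * (p - 1) + c - (1 - α) / 2 with he
  have hev := (eventually_lt_mul_natCast 4 (α * (δ / p)) (by positivity)).and <|
    (eventually_lt_mul_natCast 8 α h0).and <|
    (eventually_lt_mul_natCast D 1 one_pos).and <|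
    (eventually_lt_mul_natCast (D * C + 2 * (1 / 2 + (1 - α) * p / α))
      (α / 2 + (1 - α)) (by positivity)).and <|
    (eventually_lt_mul_natCast (α * p - e) α h0).and <|
    (eventually_lt_mul_natCast (-e) α h0).and <|
    (eventually_lt_mul_natCast ((c - (1 - α) / 2) * (e - α * p) + c * α * p)
      ((1 - α) / 2 * α) (by positivity)).and <|
    Filter.eventually_ge_atTop p
  obtain ⟨N, hN⟩ := Filter.eventually_atTop.1 hev
  refine ⟨N, fun n hn G _ hfree hrho => ?_⟩
  obtain ⟨hn1, hn2, hn3, hn4, hn5, hn6, hn7, hpn⟩ := hN n hn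
  have : NeZero n := ⟨by omega⟩
  have hcα : c * α = (1 - α) ^ 2 * p := div_mul_cancel₀ _ h0.ne'
  have hs : α * n + e ≤ rhoAlpha α (Snp n p) := by
    refine rhoAlpha_Snp_lower n p hp1 hpn α _ (by linarith) ?_
    rw [← hcα]
    have h2 : α * n + e - (α * (n - 1) + (1 - α) * (p - 1)) = c - (1 - α) / 2 := by
      rw [he]; ring
    rw [h2]
    nlinarith
  obtain ⟨y, u, hy0, hy1, hu, hy⟩ :=
    exists_normalized_subsolution G α h0 h1 (by linarith)
  have hcard := le_card_highDegree hp1 G α (δ / p) C (rhoAlpha α G) B D h0 h1 hθ (by positivity)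
    hB hD (sum_adjMat_le G k hfree) (by linarith) hn1 hn2 (by linarith) hn4 y u hy0 hy1 hu hy
  obtain ⟨A, hA, hAp⟩ := Finset.exists_subset_card_eq hcard
  exact ⟨A, hAp, lt_ncard_commonNeighbors hp1 G δ A hAp fun a ha => by
    simpa using hA ha⟩
end
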